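/- Let (F, Ω_F), F = {f_j}_{j∈Λ̃}, be a finite holomorphic IFS with the strong separation condition and attractor A. For each pair of finite words v, ṽ ∈ Λ̃*, let R_{v,ṽ} := f_v ∘ f_ṽ ∘ f_v^{-1}, which maps the domain f_v(Ω_F) into itself and has a unique fixed point there. Then: (i) for each l ∈ ℕ and each R_{v,ṽ}, there exist precisely l different local solutions g^{(r)}_{v,ṽ,l}, r = 1, …, l (defined and holomorphic in a neighborhood of the fixed point of R_{v,ṽ}), of the equation g^l = R_{v,ṽ}, where g^l denotes the l-th iterate of g; and (ii) if (G, Ω_G) is any other holomorphic IFS with the strong separation condition and the same attractor A, then there exists K ∈ ℕ such that every g_i ∈ G is a holomorphic continuation of one of the local functions g^{(r)}_{v,ṽ,l} with v, ṽ ∈ Λ̃*, l ∈ {1, …, K}, r ∈ {1, …, l}. -/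

import Mathlib

open Set Metric

noncomputable section

/-- A finite holomorphic IFS: a bounded domain `Ω ⊂ ℂ` together with finitely many
univalent maps `g i : Ω → Ω` with `closure (g i '' Ω) ⊆ Ω`. -/
structure HolIFS where
  /-- the number of maps -/
  m : ℕ
  hm : 1 ≤ m
  /-- the domain -/
  Ω : Set ℂ
  hopen : IsOpen Ω
  hconn : IsConnected Ω
  hbdd : Bornology.IsBounded Ω
  /-- the maps of the IFS -/
  g : Fin m → ℂ → ℂ
  hdiff : ∀ i, DifferentiableOn ℂ (g i) Ω
  hinj : ∀ i, Set.InjOn (g i) Ω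
  hcl : ∀ i, closure (g i '' Ω) ⊆ Ω

/-- `A` is the attractor of the IFS `S`: the (unique) nonempty compact subset of `Ω`
with `A = ⋃ i, g i '' A`. -/
def HolIFS.IsAttractor (S : HolIFS) (A : Set ℂ) : Prop :=
  A.Nonempty ∧ IsCompact A ∧ A ⊆ S.Ω ∧ A = ⋃ i, S.g i '' A

/-- The strong separation condition for the IFS `S` with attractor `A`. -/
def HolIFS.SSC (S : HolIFS) (A : Set ℂ) : Prop :=
  ∀ i j : Fin S.m, i ≠ j → Disjoint (S.g i '' A) (S.g j '' A)

/-- For a finite word `w = [i₁, …, i_k]`, the composition `g_w = g i₁ ∘ ⋯ ∘ g i_k`. -/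
def HolIFS.word (S : HolIFS) (w : List (Fin S.m)) : ℂ → ℂ :=
  w.foldr (fun i f => S.g i ∘ f) id

/-- `g` is a local solution of `g^l = R` at the point `b` within the set `S`: `g` is
defined and holomorphic on an open neighborhood `W ⊆ S` of `b`, fixes `b`, and its
`l`-th iterate equals `R` on `W`. -/
def IsLocalSolOn (R : ℂ → ℂ) (S : Set ℂ) (b : ℂ) (l : ℕ) (g : ℂ → ℂ) : Prop :=
  ∃ W : Set ℂ, IsOpen W ∧ b ∈ W ∧ W ⊆ S ∧ DifferentiableOn ℂ g W ∧ g b = b ∧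
    ∀ z ∈ W, g^[l] z = R z

section Helpers

open Filter Topology

lemma aux_deriv_ne_zero {f : ℂ → ℂ} {Ω : Set ℂ} (hΩ : IsOpen Ω) (hf : DifferentiableOn ℂ f Ω)
    (hinj : InjOn f Ω) {a : ℂ} (ha : a ∈ Ω) : deriv f a ≠ 0 := by
  have han : AnalyticAt ℂ f a := hf.analyticAt (hΩ.mem_nhds ha)
  have han2 : AnalyticAt ℂ (fun z => f z - f a) a := han.sub analyticAt_const
  have hnc : ¬ ∀ᶠ z in 𝓝 a, f z - f a = 0 := by
    intro h
    have h2 : ∀ᶠ z in 𝓝[≠] a, False := by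
      filter_upwards [nhdsWithin_le_nhds h, nhdsWithin_le_nhds (hΩ.mem_nhds ha),
        self_mem_nhdsWithin] with z hz hzΩ hne
      exact hne (hinj hzΩ ha (sub_eq_zero.1 hz))
    exact (inferInstance : (𝓝[≠] a).NeBot).ne (by simpa using h2)
  obtain ⟨n, g, hg, hg0, hfg⟩ := (han2.exists_eventuallyEq_pow_smul_nonzero_iff).2 hnc
  have hn0 : n ≠ 0 := by
    rintro rfl
    have := hfg.self_of_nhds
    simp at this
    exact hg0 this.symm
  have hder : deriv f a = deriv (fun z => (z - a) ^ n • g z) a := by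
    rw [← (EventuallyEq.deriv_eq hfg)]; simp
  obtain ⟨c, hc⟩ := IsAlgClosed.exists_pow_nat_eq (g a) (Nat.pos_of_ne_zero hn0)
  have hc0 : c ≠ 0 := by rintro rfl; rw [zero_pow hn0] at hc; exact hg0 hc.symm
  set k : ℂ → ℂ := fun z => (z - a) * (c * (g z / g a) ^ ((1:ℂ) / n)) with hk
  have hq : AnalyticAt ℂ (fun z => c * (g z / g a) ^ ((1:ℂ) / n)) a := by
    refine analyticAt_const.mul (AnalyticAt.cpow (hg.div analyticAt_const hg0) analyticAt_const ?_)
    simp [div_self hg0]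
  have hka : AnalyticAt ℂ k a := (analyticAt_id.sub analyticAt_const).mul hq
  have hkd : HasDerivAt k c a := by
    have h1 : HasDerivAt (fun z : ℂ => z - a) 1 a := (hasDerivAt_id a).sub_const a
    have := h1.fun_mul hq.differentiableAt.hasDerivAt
    simpa [hk, div_self hg0] using this
  have hkn : ∀ᶠ z in 𝓝 a, k z ^ n = f z - f a := by
    filter_upwards [hfg] with z hz
    rw [hz, hk]
    simp only [mul_pow, smul_eq_mul, one_div]
    rw [Complex.cpow_nat_inv_pow _ hn0, hc]
    field_simp
  have hmap : map k (𝓝 a) = 𝓝 0 := by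
    have := (hkd.deriv ▸ hka.hasStrictDerivAt : HasStrictDerivAt k c a).map_nhds_eq hc0
    simpa [hk] using this
  set N := {z | z ∈ Ω ∧ k z ^ n = f z - f a}
  have hN : N ∈ 𝓝 a := by filter_upwards [hΩ.mem_nhds ha, hkn] with z h1 h2 using ⟨h1, h2⟩
  have hkN : k '' N ∈ 𝓝 (0:ℂ) := hmap ▸ image_mem_map hN
  by_cases hn1 : n = 1
  · subst hn1
    intro h0
    have : HasDerivAt (fun z => f z - f a) (deriv f a) a := han.differentiableAt.hasDerivAt.sub_const _
    have h3 : HasDerivAt (fun z => f z - f a) c a := hkd.congr_of_eventuallyEq (by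
      filter_upwards [hkn] with z hz; simpa using hz.symm)
    rw [this.unique h3] at h0
    exact hc0 h0
  exfalso
  set ω := Complex.exp (2 * Real.pi * Complex.I / n)
  have hω : IsPrimitiveRoot ω n := Complex.isPrimitiveRoot_exp n hn0
  have hω1 : ω ≠ 1 := hω.ne_one (by omega)
  have hpre : (fun e : ℂ => ω * e) ⁻¹' (k '' N) ∈ 𝓝 (0:ℂ) := by
    apply (continuous_const_mul ω).continuousAt.preimage_mem_nhds
    simpa using hkN
  have hA1 : ∀ᶠ e in 𝓝[≠] (0:ℂ), e ∈ k '' N := nhdsWithin_le_nhds hkN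
  have hA2 : ∀ᶠ e in 𝓝[≠] (0:ℂ), e ∈ (fun e : ℂ => ω * e) ⁻¹' (k '' N) := nhdsWithin_le_nhds hpre
  have hA3 : ∀ᶠ e in 𝓝[≠] (0:ℂ), e ∈ ({0}ᶜ : Set ℂ) := self_mem_nhdsWithin
  obtain ⟨e, h1, h2, he⟩ := (hA1.and (hA2.and hA3)).exists
  obtain ⟨z1, hz1, hk1⟩ := h1
  obtain ⟨z2, hz2, hk2⟩ := h2
  have he0 : e ≠ 0 := he
  have hff : f z1 = f z2 := by
    have e1 := hz1.2
    have e2 := hz2.2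
    rw [hk1] at e1
    rw [hk2, mul_pow, hω.pow_eq_one, one_mul, e1] at e2
    simpa using e2
  have := hinj hz1.1 hz2.1 hff
  rw [this, hk2] at hk1
  apply hω1
  field_simp at hk1
  exact hk1

/-- quadratic bounds -/
lemma aux_quad {f : ℂ → ℂ} {b : ℂ} (hf : AnalyticAt ℂ f b) (h0 : f b = 0) (h1 : deriv f b = 0) :
    ∃ M : ℝ, 0 ≤ M ∧ ∀ᶠ z in 𝓝 b, ‖f z‖ ≤ M * ‖z - b‖ ^ 2 := by
  have h2 : (2:ℕ∞) ≤ analyticOrderAt f b := by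
    by_contra hlt
    push Not at hlt
    have h3 : analyticOrderAt f b = 0 ∨ analyticOrderAt f b = 1 := by
      generalize analyticOrderAt f b = o at *
      induction o with
      | top => simp at hlt
      | coe n => norm_cast at *; omega
    rcases h3 with h3 | h3
    · exact (hf.analyticOrderAt_eq_zero.1 h3) h0
    · obtain ⟨g, hg, hg0, hfg⟩ := (hf.analyticOrderAt_eq_natCast (n := 1)).1 (by simpa using h3)
      have hd : HasDerivAt (fun z => (z - b) ^ 1 • g z) (g b) b := by
        have h1 : HasDerivAt (fun z : ℂ => z - b) 1 b := (hasDerivAt_id b).sub_const b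
        simpa using h1.fun_mul hg.differentiableAt.hasDerivAt
      rw [EventuallyEq.deriv_eq hfg, hd.deriv] at h1
      exact hg0 h1
  obtain ⟨g, hg, hfg⟩ := (natCast_le_analyticOrderAt hf (n := 2)).1 (by exact_mod_cast h2)
  refine ⟨‖g b‖ + 1, by positivity, ?_⟩
  have : ∀ᶠ z in 𝓝 b, ‖g z‖ < ‖g b‖ + 1 := hg.continuousAt.norm.eventually_lt continuousAt_const (by simp)
  filter_upwards [hfg, this] with z hz h
  rw [hz, norm_smul, norm_pow, mul_comm]
  gcongr

lemma aux_contr {f : ℂ → ℂ} {b : ℂ} {s : ℝ} (hf : AnalyticAt ℂ f b) (hb : f b = b)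
    (hs : ‖deriv f b‖ < s) : ∀ᶠ z in 𝓝 b, ‖f z - b‖ ≤ s * ‖z - b‖ := by
  have h := hf.differentiableAt.hasDerivAt.isLittleO
  have h2 := h.def (sub_pos.2 hs)
  filter_upwards [h2] with z hz
  rw [hb] at hz
  have : ‖f z - b‖ ≤ ‖f z - b - (z - b) • deriv f b‖ + ‖(z - b) • deriv f b‖ := by
    simpa using norm_add_le (f z - b - (z - b) • deriv f b) ((z - b) • deriv f b)
  rw [norm_smul] at this
  nlinarith

lemma aux_iter {f : ℂ → ℂ} {b : ℂ} {s r : ℝ} (hs0 : 0 ≤ s) (hs1 : s ≤ 1)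
    (h : ∀ z ∈ ball b r, ‖f z - b‖ ≤ s * ‖z - b‖) (n : ℕ) :
    ∀ z ∈ ball b r, ‖f^[n] z - b‖ ≤ s ^ n * ‖z - b‖ ∧ f^[n] z ∈ ball b r := by
  induction n with
  | zero => intro z hz; simpa using hz
  | succ n ih =>
    intro z hz
    obtain ⟨h1, h2⟩ := ih z hz
    rw [Function.iterate_succ_apply']
    have h3 := h _ h2
    refine ⟨?_, ?_⟩
    · calc _ ≤ _ := h3
        _ ≤ s * (s ^ n * ‖z - b‖) := by gcongr
        _ = _ := by ring
    · rw [mem_ball, dist_eq_norm] at *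
      nlinarith [norm_nonneg (f^[n] z - b)]

lemma aux_lin_zero {f k : ℂ → ℂ} {b : ℂ} (hf : AnalyticAt ℂ f b) (hb : f b = b)
    (h0 : 0 < ‖deriv f b‖) (h1 : ‖deriv f b‖ < 1) (hk : AnalyticAt ℂ k b) (hkb : k b = 0)
    (hk' : deriv k b = 0) (heq : ∀ᶠ z in 𝓝 b, k (f z) = deriv f b * k z) :
    ∀ᶠ z in 𝓝 b, k z = 0 := by
  set lam := deriv f b
  obtain ⟨s, hs1, hs2⟩ : ∃ s, ‖lam‖ < s ∧ s < Real.sqrt ‖lam‖ := exists_between (by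
    rw [Real.lt_sqrt (norm_nonneg _)]; nlinarith)
  have hs0 : 0 < s := h0.trans hs1
  have hss : s ^ 2 < ‖lam‖ := (Real.lt_sqrt hs0.le).1 hs2
  have hs3 : s < 1 := by nlinarith
  obtain ⟨M, hM, hq⟩ := aux_quad hk hkb hk'
  obtain ⟨r, hr, hball⟩ := Metric.eventually_nhds_iff_ball.1 ((aux_contr hf hb hs1).and (hq.and heq))
  have hit := aux_iter hs0.le hs3.le (fun z hz => (hball z hz).1)
  filter_upwards [ball_mem_nhds b hr] with z hz
  have hkn : ∀ n : ℕ, k (f^[n] z) = lam ^ n * k z := by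
    intro n
    induction n with
    | zero => simp
    | succ n ih =>
      rw [Function.iterate_succ_apply', (hball _ (hit n z hz).2).2.2, ih]; ring
  have hle : ∀ n : ℕ, ‖k z‖ ≤ M * ‖z - b‖ ^ 2 * (s ^ 2 / ‖lam‖) ^ n := by
    intro n
    have e1 := (hball _ (hit n z hz).2).2.1
    have e2 := (hit n z hz).1
    rw [hkn, norm_mul, norm_pow] at e1
    have e3 : ‖lam‖ ^ n * ‖k z‖ ≤ M * (s ^ n * ‖z - b‖) ^ 2 := e1.trans (by gcongr)
    rw [div_pow, ← mul_div_assoc, le_div_iff₀ (by positivity)]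
    calc _ = ‖lam‖ ^ n * ‖k z‖ := by ring
      _ ≤ _ := e3
      _ = _ := by ring
  have hlim : Tendsto (fun n : ℕ => M * ‖z - b‖ ^ 2 * (s ^ 2 / ‖lam‖) ^ n) atTop (𝓝 (M * ‖z - b‖ ^ 2 * 0)) :=
    (tendsto_pow_atTop_nhds_zero_of_lt_one (by positivity) ((div_lt_one h0).2 hss)).const_mul _
  have := ge_of_tendsto' hlim hle
  simpa using this

lemma aux_koenigs {f : ℂ → ℂ} {b : ℂ} (hf : AnalyticAt ℂ f b) (hb : f b = b)
    (h0 : 0 < ‖deriv f b‖) (h1 : ‖deriv f b‖ < 1) :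
    ∃ φ : ℂ → ℂ, AnalyticAt ℂ φ b ∧ φ b = 0 ∧ deriv φ b = 1 ∧
      ∀ᶠ z in 𝓝 b, φ (f z) = deriv f b * φ z := by
  set lam := deriv f b with hlam
  have hl0 : lam ≠ 0 := norm_pos_iff.1 h0
  obtain ⟨s, hs1, hs2⟩ : ∃ s, ‖lam‖ < s ∧ s < Real.sqrt ‖lam‖ := exists_between (by
    rw [Real.lt_sqrt (norm_nonneg _)]; nlinarith)
  have hs0 : 0 < s := h0.trans hs1
  have hss : s ^ 2 < ‖lam‖ := (Real.lt_sqrt hs0.le).1 hs2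
  have hs3 : s < 1 := by nlinarith
  have hk : AnalyticAt ℂ (fun z => f z - b - lam * (z - b)) b :=
    (hf.sub analyticAt_const).sub (analyticAt_const.mul (analyticAt_id.sub analyticAt_const))
  have hkd : deriv (fun z => f z - b - lam * (z - b)) b = 0 := by
    have e1 : HasDerivAt (fun z => f z - b) lam b := hf.differentiableAt.hasDerivAt.sub_const b
    have e2 : HasDerivAt (fun z => lam * (z - b)) (lam * 1) b :=
      ((hasDerivAt_id b).sub_const b).const_mul lam
    have := (e1.fun_sub e2).deriv
    rw [this]; ring
  obtain ⟨M, hM, hq⟩ := aux_quad hk (by simp [hb]) hkd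
  obtain ⟨r, hr, hball⟩ := Metric.eventually_nhds_iff_ball.1
    ((aux_contr hf hb hs1).and (hq.and hf.eventually_analyticAt))
  have hit := aux_iter hs0.le hs3.le (fun z hz => (hball z hz).1)
  have hfd : DifferentiableOn ℂ f (ball b r) := fun z hz =>
    (hball z hz).2.2.differentiableAt.differentiableWithinAt
  have hitd : ∀ n : ℕ, DifferentiableOn ℂ (f^[n]) (ball b r) := by
    intro n
    induction n with
    | zero => exact differentiableOn_id
    | succ n ih =>
      rw [Function.iterate_succ']
      exact hfd.comp ih (fun z hz => (hit n z hz).2)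
  set F : ℕ → ℂ → ℂ := fun n z => (lam ^ (n + 1))⁻¹ * (f (f^[n] z) - b - lam * (f^[n] z - b)) with hF
  set q := s ^ 2 / ‖lam‖ with hqdef
  have hq1 : q < 1 := (div_lt_one h0).2 hss
  have hq0 : 0 ≤ q := by positivity
  have hFb : ∀ n, ∀ z ∈ ball b r, ‖F n z‖ ≤ (M / ‖lam‖ * ‖z - b‖ ^ 2) * q ^ n := by
    intro n z hz
    obtain ⟨e2, e0⟩ := hit n z hz
    have e1 := (hball _ e0).2.1
    rw [hF]
    simp only [norm_mul, norm_inv, norm_pow]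
    have e3 : ‖f (f^[n] z) - b - lam * (f^[n] z - b)‖ ≤ M * (s ^ n * ‖z - b‖) ^ 2 := e1.trans (by gcongr)
    rw [inv_mul_le_iff₀ (by positivity)]
    refine e3.trans (le_of_eq ?_)
    rw [hqdef, div_pow]
    field_simp
    ring
  have hFu : ∀ n, ∀ z ∈ ball b r, ‖F n z‖ ≤ (M / ‖lam‖ * r ^ 2) * q ^ n := by
    intro n z hz
    refine (hFb n z hz).trans ?_
    have : ‖z - b‖ ≤ r := by rw [← dist_eq_norm]; exact (mem_ball.1 hz).le
    gcongr
  have hsum : Summable (fun n : ℕ => (M / ‖lam‖ * r ^ 2) * q ^ n) :=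
    (summable_geometric_of_lt_one hq0 hq1).mul_left _
  have hFd : ∀ n, DifferentiableOn ℂ (F n) (ball b r) := by
    intro n
    have e1 : DifferentiableOn ℂ (fun z => f (f^[n] z)) (ball b r) :=
      hfd.comp (hitd n) (fun z hz => (hit n z hz).2)
    have e2 : DifferentiableOn ℂ (fun z => f^[n] z) (ball b r) := hitd n
    exact ((e1.sub_const b).sub ((e2.sub_const b).const_mul lam)).const_mul _
  have hSd := Complex.differentiableOn_tsum_of_summable_norm hsum hFd isOpen_ball hFu
  have hbm : b ∈ ball b r := mem_ball_self hr
  have hFsum : ∀ z ∈ ball b r, Summable (fun n => F n z) := fun z hz =>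
    Summable.of_norm_bounded hsum (fun n => hFu n z hz)
  refine ⟨fun z => (z - b) + ∑' n, F n z, ?_, ?_, ?_, ?_⟩
  · exact (((differentiableOn_id.sub_const b).add hSd).analyticAt (ball_mem_nhds b hr))
  · have : ∀ n, F n b = 0 := by
      intro n
      have := hFb n b hbm
      simpa using this
    simp [this]
  · have hd : HasDerivAt (fun z => ∑' n, F n z) 0 b := by
      have hb0 : ∑' n, F n b = 0 := by
        have : ∀ n, F n b = 0 := by
          intro n
          have := hFb n b hbm
          simpa using this
        simp [this]
      rw [hasDerivAt_iff_isLittleO]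
      simp only [hb0, sub_zero, smul_zero]
      have hO : (fun z => ∑' n, F n z) =O[𝓝 b] (fun z => (z - b) ^ 2) := by
        refine Asymptotics.IsBigO.of_bound (M / ‖lam‖ * (1 - q)⁻¹) ?_
        filter_upwards [ball_mem_nhds b hr] with z hz
        have := tsum_of_norm_bounded ((hasSum_geometric_of_lt_one hq0 hq1).mul_left
          (M / ‖lam‖ * ‖z - b‖ ^ 2)) (fun n => hFb n z hz)
        refine this.trans (le_of_eq ?_)
        rw [norm_pow]; ring
      refine hO.trans_isLittleO ?_
      have : Tendsto (fun z : ℂ => z - b) (𝓝 b) (𝓝 0) := by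
        have := (continuous_sub_right b).tendsto b
        simpa using this
      have h5 := (Asymptotics.isLittleO_pow_id (𝕜 := ℂ) (n := 2) (by norm_num)).comp_tendsto this
      simpa [Function.comp_def] using h5
    have := (((hasDerivAt_id b).sub_const b).fun_add hd).deriv
    simpa using this
  · filter_upwards [ball_mem_nhds b hr] with z hz
    have e1 : ∀ n, F n (f z) = lam * F (n + 1) z := by
      intro n
      simp only [hF, Function.iterate_succ_apply]
      rw [pow_succ lam (n + 1)]
      field_simp
    simp only [e1]
    rw [tsum_mul_left, (hFsum z hz).tsum_eq_zero_add]
    simp only [hF, Function.iterate_zero, id]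
    field_simp
    ring

lemma aux_inj_near {φ : ℂ → ℂ} {b : ℂ} (hφ : AnalyticAt ℂ φ b) (hd : deriv φ b ≠ 0) :
    ∃ U ∈ 𝓝 b, InjOn φ U := by
  have h := HasStrictDerivAt.eventually_left_inverse hφ.hasStrictDerivAt hd
  exact ⟨_, h, fun x hx y hy hxy => by
    have h1 : _ = x := hx
    have h2 : _ = y := hy
    rw [← h1, ← h2, hxy]⟩

lemma aux_roots {R : ℂ → ℂ} {b : ℂ} (hR : AnalyticAt ℂ R b) (hb : R b = b)
    (h0 : 0 < ‖deriv R b‖) (h1 : ‖deriv R b‖ < 1) {S : Set ℂ} (hS : S ∈ 𝓝 b) {l : ℕ} (hl : 1 ≤ l) :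
    ∃ gs : Fin l → ℂ → ℂ,
      (∀ s, IsLocalSolOn R S b l (gs s)) ∧
      (∀ s s' : Fin l, s ≠ s' → ¬ (gs s =ᶠ[nhds b] gs s')) ∧
      (∀ h : ℂ → ℂ, IsLocalSolOn R S b l h → ∃ s, h =ᶠ[nhds b] gs s) := by
  have hl0 : l ≠ 0 := by omega
  obtain ⟨φ, hφ, hφb, hφd, hφR⟩ := aux_koenigs hR hb h0 h1
  set lam := deriv R b with hlam
  have hφd0 : deriv φ b ≠ 0 := by rw [hφd]; exact one_ne_zero
  set ψ := hφ.hasStrictDerivAt.localInverse _ _ _ hφd0 with hψdef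
  have hψ : AnalyticAt ℂ ψ 0 := by rw [← hφb]; exact hφ.analyticAt_localInverse hφd0
  have hψ1 : ∀ᶠ z in 𝓝 b, ψ (φ z) = z := HasStrictDerivAt.eventually_left_inverse hφ.hasStrictDerivAt hφd0
  have hψ2 : ∀ᶠ z in 𝓝 (0:ℂ), φ (ψ z) = z := by
    have := HasStrictDerivAt.eventually_right_inverse hφ.hasStrictDerivAt hφd0
    rwa [hφb] at this
  have hψ0 : ψ 0 = b := by have := hψ1.self_of_nhds; rwa [hφb] at this
  obtain ⟨m, hm⟩ := IsAlgClosed.exists_pow_nat_eq lam (Nat.pos_of_ne_zero hl0)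
  have hm0 : m ≠ 0 := by
    rintro rfl; rw [zero_pow hl0] at hm; rw [← hm] at h0; simp at h0
  set ω := Complex.exp (2 * Real.pi * Complex.I / l)
  have hω : IsPrimitiveRoot ω l := Complex.isPrimitiveRoot_exp l hl0
  have hφt : ∀ c : ℂ, Tendsto (fun z => c * φ z) (𝓝 b) (𝓝 0) := by
    intro c
    have := (hφ.continuousAt.tendsto).const_mul c
    simpa [hφb] using this
  set G : ℂ → ℂ → ℂ := fun c z => ψ (c * φ z) with hG
  have hGb : ∀ c, G c b = b := by intro c; simp [hG, hφb, hψ0]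
  have hGa : ∀ c, AnalyticAt ℂ (G c) b := by
    intro c
    refine AnalyticAt.fun_comp (g := ψ) (f := fun z => c * φ z) ?_ (analyticAt_const.mul hφ)
    simpa [hφb] using hψ
  have hGφ : ∀ c, ∀ᶠ z in 𝓝 b, φ (G c z) = c * φ z := fun c => (hφt c).eventually hψ2
  have hGt : ∀ c, Tendsto (G c) (𝓝 b) (𝓝 b) := by
    intro c; have := (hGa c).continuousAt.tendsto; rwa [hGb] at this
  have hit : ∀ {h : ℂ → ℂ}, Tendsto h (𝓝 b) (𝓝 b) → ∀ n : ℕ, Tendsto h^[n] (𝓝 b) (𝓝 b) := by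
    intro h hh n
    induction n with
    | zero => exact tendsto_id
    | succ n ih => rw [Function.iterate_succ]; exact ih.comp hh
  have hGn : ∀ c (n : ℕ), ∀ᶠ z in 𝓝 b, φ ((G c)^[n] z) = c ^ n * φ z := by
    intro c n
    induction n with
    | zero => simp
    | succ n ih =>
      filter_upwards [ih, (hit (hGt c) n).eventually (hGφ c)] with z h1 h2
      rw [Function.iterate_succ_apply', h2, h1]; ring
  have hRt : Tendsto R (𝓝 b) (𝓝 b) := by
    have := hR.continuousAt.tendsto; rwa [hb] at this
  refine ⟨fun s => G (m * ω ^ (s : ℕ)), ?_, ?_, ?_⟩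
  · intro s
    set c := m * ω ^ (s : ℕ) with hc
    have hcl : c ^ l = lam := by
      rw [hc, mul_pow, hm, ← pow_mul, mul_comm (s : ℕ), pow_mul, hω.pow_eq_one, one_pow, mul_one]
    have hev : ∀ᶠ z in 𝓝 b, z ∈ S ∧ DifferentiableAt ℂ (G c) z ∧ (G c)^[l] z = R z := by
      filter_upwards [hS, (hGa c).eventually_analyticAt, hGn c l, hφR, hRt.eventually hψ1,
        (hit (hGt c) l).eventually hψ1] with z e1 e2 e3 e4 e5 e6
      refine ⟨e1, e2.differentiableAt, ?_⟩
      rw [← e5, ← e6, e3, e4, hcl]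
    obtain ⟨W, hW, hWo, hbW⟩ := _root_.eventually_nhds_iff.1 hev
    exact ⟨W, hWo, hbW, fun z hz => (hW z hz).1, fun z hz => (hW z hz).2.1.differentiableWithinAt,
      hGb c, fun z hz => (hW z hz).2.2⟩
  · intro s s' hne heq
    have hd : ∀ c, deriv (G c) b = c := by
      intro c
      have e1 : HasDerivAt (fun z => c * φ z) (c * 1) b := by
        have := hφ.differentiableAt.hasDerivAt.const_mul c
        rwa [hφd] at this
      have e2 : HasDerivAt (fun z => φ (G c z)) (1 * deriv (G c) b) b := by
        refine HasDerivAt.comp b (h₂ := φ) (h := G c) ?_ (hGa c).differentiableAt.hasDerivAt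
        rw [hGb, ← hφd]; exact hφ.differentiableAt.hasDerivAt
      have e3 := e1.congr_of_eventuallyEq (hGφ c)
      simpa using e2.unique e3
    have := heq.deriv_eq
    rw [hd, hd] at this
    exact hne (Fin.ext (hω.pow_inj s.2 s'.2 (mul_left_cancel₀ hm0 this)))
  · rintro h ⟨W, hWo, hbW, hWS, hWd, hhb, hhl⟩
    have hha : AnalyticAt ℂ h b := hWd.analyticAt (hWo.mem_nhds hbW)
    have hht : Tendsto h (𝓝 b) (𝓝 b) := by
      have := hha.continuousAt.tendsto; rwa [hhb] at this
    have hhR : ∀ᶠ z in 𝓝 b, h^[l] z = R z := by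
      filter_upwards [hWo.mem_nhds hbW] with z hz using hhl z hz
    have hcomm : ∀ᶠ z in 𝓝 b, h (R z) = R (h z) := by
      filter_upwards [hhR, hht.eventually hhR] with z e1 e2
      rw [← e1, ← e2, ← Function.iterate_succ_apply' h, ← Function.iterate_succ_apply h]
    set c := deriv h b with hc
    have hcl : c ^ l = lam := by
      have e1 : HasDerivAt h^[l] (c ^ l) b := by
        exact HasDerivAt.iterate (hf := hha.differentiableAt.hasDerivAt) (hx := hhb) (n := l)
      rw [hlam, ← EventuallyEq.deriv_eq hhR, e1.deriv]
    have hχa : AnalyticAt ℂ (fun z => φ (h z)) b := by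
      refine AnalyticAt.fun_comp (g := φ) (f := h) ?_ hha
      rwa [hhb]
    have hχd : HasDerivAt (fun z => φ (h z)) (1 * c) b := by
      refine HasDerivAt.comp b (h₂ := φ) (h := h) ?_ hha.differentiableAt.hasDerivAt
      rw [hhb, ← hφd]; exact hφ.differentiableAt.hasDerivAt
    have key : ∀ᶠ z in 𝓝 b, φ (h z) - c * φ z = 0 := by
      refine aux_lin_zero hR hb h0 h1 (k := fun z => φ (h z) - c * φ z) (hχa.sub (analyticAt_const.mul hφ)) ?_ ?_ ?_
      · simp [hhb, hφb]
      · have e1 : HasDerivAt (fun z => c * φ z) (c * 1) b := by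
          have := hφ.differentiableAt.hasDerivAt.const_mul c
          rwa [hφd] at this
        rw [(hχd.fun_sub e1).deriv]; ring
      · filter_upwards [hcomm, hφR, hht.eventually hφR] with z e1 e2 e3
        rw [e1, e2, e3]; ring
    haveI : NeZero l := ⟨hl0⟩
    obtain ⟨i, hi, hic⟩ : ∃ i < l, ω ^ i = c / m := by
      apply hω.eq_pow_of_pow_eq_one
      rw [div_pow, hcl, hm, div_self]
      exact norm_pos_iff.1 h0
    refine ⟨⟨i, hi⟩, ?_⟩
    have : m * ω ^ i = c := by rw [hic]; field_simp
    simp only [this]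
    filter_upwards [key, hht.eventually hψ1] with z e1 e2
    rw [hG]
    simp only
    rw [← sub_eq_zero.1 e1, e2]

namespace HolIFS

lemma word_nil' (S : HolIFS) (x : ℂ) : S.word [] x = x := rfl

lemma word_cons' (S : HolIFS) (i : Fin S.m) (w : List (Fin S.m)) (x : ℂ) :
    S.word (i :: w) x = S.g i (S.word w x) := rfl

lemma word_append' (S : HolIFS) (v w : List (Fin S.m)) (x : ℂ) :
    S.word (v ++ w) x = S.word v (S.word w x) := by
  induction v with
  | nil => rfl
  | cons i v ih => rw [List.cons_append, word_cons', ih, word_cons']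

lemma g_mem (S : HolIFS) (i : Fin S.m) {x : ℂ} (hx : x ∈ S.Ω) : S.g i x ∈ S.Ω :=
  S.hcl i (subset_closure (mem_image_of_mem _ hx))

lemma word_mem (S : HolIFS) (w : List (Fin S.m)) {x : ℂ} (hx : x ∈ S.Ω) : S.word w x ∈ S.Ω := by
  induction w with
  | nil => exact hx
  | cons i v ih => exact S.g_mem i ih

lemma word_diff (S : HolIFS) (w : List (Fin S.m)) : DifferentiableOn ℂ (S.word w) S.Ω := by
  induction w with
  | nil => exact differentiableOn_id
  | cons i v ih => exact (S.hdiff i).comp ih (fun x hx => S.word_mem v hx)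

lemma word_inj (S : HolIFS) (w : List (Fin S.m)) : InjOn (S.word w) S.Ω := by
  induction w with
  | nil => exact fun x _ y _ h => h
  | cons i v ih => exact (S.hinj i).comp ih (fun x hx => S.word_mem v hx)

lemma word_diffAt (S : HolIFS) (w : List (Fin S.m)) {x : ℂ} (hx : x ∈ S.Ω) :
    DifferentiableAt ℂ (S.word w) x := (S.word_diff w).differentiableAt (S.hopen.mem_nhds hx)

lemma g_diffAt (S : HolIFS) (i : Fin S.m) {x : ℂ} (hx : x ∈ S.Ω) :
    DifferentiableAt ℂ (S.g i) x := (S.hdiff i).differentiableAt (S.hopen.mem_nhds hx)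

lemma deriv_word_cons (S : HolIFS) (i : Fin S.m) (w : List (Fin S.m)) {x : ℂ} (hx : x ∈ S.Ω) :
    deriv (S.word (i :: w)) x = deriv (S.g i) (S.word w x) * deriv (S.word w) x :=
  deriv_comp x (S.g_diffAt i (S.word_mem w hx)) (S.word_diffAt w hx)

lemma deriv_word_append (S : HolIFS) (v w : List (Fin S.m)) {x : ℂ} (hx : x ∈ S.Ω) :
    deriv (S.word (v ++ w)) x = deriv (S.word v) (S.word w x) * deriv (S.word w) x := by
  have : S.word (v ++ w) = S.word v ∘ S.word w := funext fun x => S.word_append' v w x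
  rw [this]
  exact deriv_comp x (S.word_diffAt v (S.word_mem w hx)) (S.word_diffAt w hx)

lemma deriv_word_ne (S : HolIFS) (w : List (Fin S.m)) {x : ℂ} (hx : x ∈ S.Ω) :
    deriv (S.word w) x ≠ 0 := aux_deriv_ne_zero S.hopen (S.word_diff w) (S.word_inj w) hx

lemma exists_core (S : HolIFS) : ∃ K : Set ℂ, IsCompact K ∧ K ⊆ S.Ω ∧
    ∀ i, ∀ x ∈ S.Ω, S.g i x ∈ K := by
  refine ⟨⋃ i, closure (S.g i '' S.Ω), ?_, iUnion_subset S.hcl, ?_⟩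
  · refine isCompact_iUnion fun i => ?_
    exact (S.hbdd.subset (image_subset_iff.2 fun x hx => S.g_mem i hx)).isCompact_closure
  · intro i x hx
    exact mem_iUnion.2 ⟨i, subset_closure (mem_image_of_mem _ hx)⟩

lemma exists_delta (S : HolIFS) : ∃ δ : ℝ, 0 < δ ∧ ∀ i, ∀ p ∈ S.Ω, ∀ z ∈ S.Ω,
    S.g i z + δ * (S.g i z - S.g i p) ∈ S.Ω := by
  obtain ⟨K, hK, hKΩ, hgK⟩ := S.exists_core
  obtain ⟨η, hη, hth⟩ := hK.exists_thickening_subset_open S.hopen hKΩ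
  obtain ⟨D, hD⟩ := S.hbdd.exists_norm_le
  have hD0 : 0 ≤ D := by
    obtain ⟨x, hx⟩ := S.hconn.nonempty
    exact (norm_nonneg _).trans (hD x hx)
  refine ⟨η / (2 * D + 1), by positivity, fun i p hp z hz => hth ?_⟩
  rw [mem_thickening_iff]
  refine ⟨S.g i z, hgK i z hz, ?_⟩
  rw [dist_eq_norm, add_sub_cancel_left, norm_mul, Complex.norm_real, Real.norm_of_nonneg (by positivity)]
  have h1 : ‖S.g i z - S.g i p‖ ≤ D + D :=
    (norm_sub_le _ _).trans (add_le_add (hD _ (S.g_mem i hz)) (hD _ (S.g_mem i hp)))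
  calc η / (2 * D + 1) * ‖S.g i z - S.g i p‖ ≤ η / (2 * D + 1) * (D + D) := by gcongr
    _ < η := by rw [div_mul_eq_mul_div, div_lt_iff₀ (by positivity)]; nlinarith

lemma schwarz_word (S : HolIFS) {δ : ℝ} (hδ : 0 < δ) (h : ∀ i, ∀ p ∈ S.Ω, ∀ z ∈ S.Ω,
    S.g i z + δ * (S.g i z - S.g i p) ∈ S.Ω) (w : List (Fin S.m)) :
    ∀ ψ : ℂ → ℂ, DifferentiableOn ℂ ψ S.Ω → (∀ z ∈ S.Ω, ‖ψ z‖ ≤ 1) →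
      ∀ (x : ℂ) (r : ℝ), 0 < r → closedBall x r ⊆ S.Ω →
      ‖deriv ψ (S.word w x)‖ * ‖deriv (S.word w) x‖ * (1 + δ) ^ w.length ≤ 1 / r := by
  induction w with
  | nil =>
    intro ψ hψ hψ1 x r hr hx
    have e : S.word [] = id := rfl
    rw [e]
    simp only [id, deriv_id, norm_one, mul_one, List.length_nil, pow_zero]
    refine Complex.norm_deriv_le_of_forall_mem_sphere_norm_le hr (hψ.diffContOnCl_ball hx) ?_
    exact fun z hz => hψ1 z (hx (sphere_subset_closedBall hz))
  | cons i w ih =>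
    intro ψ hψ hψ1 x r hr hx
    have hxΩ : x ∈ S.Ω := hx (mem_closedBall_self hr.le)
    set p := S.word w x with hp
    have hpΩ : p ∈ S.Ω := S.word_mem w hxΩ
    set G : ℂ → ℂ := fun z => S.g i z + δ * (S.g i z - S.g i p) with hG
    have hGd : DifferentiableOn ℂ G S.Ω :=
      (S.hdiff i).add (((S.hdiff i).sub_const _).const_mul _)
    have hGp : G p = S.g i p := by simp [hG]
    have hGder : HasDerivAt G ((1 + δ) * deriv (S.g i) p) p := by
      have e := (S.g_diffAt i hpΩ).hasDerivAt
      have := e.fun_add ((e.sub_const (S.g i p)).const_mul (δ:ℂ))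
      have h' : (1 + δ : ℂ) * deriv (S.g i) p = deriv (S.g i) p + δ * deriv (S.g i) p := by ring
      rw [h']; exact this
    have hψG := ih (ψ ∘ G) (hψ.comp hGd (fun z hz => h i p hpΩ z hz))
      (fun z hz => hψ1 _ (h i p hpΩ z hz)) x r hr hx
    have hcomp : deriv (ψ ∘ G) p = deriv ψ (S.g i p) * ((1 + δ) * deriv (S.g i) p) := by
      have e1 : HasDerivAt ψ (deriv ψ (G p)) (G p) :=
        (hψ.differentiableAt (S.hopen.mem_nhds (h i p hpΩ p hpΩ))).hasDerivAt
      rw [(e1.comp p hGder).deriv, hGp]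
    rw [hcomp] at hψG
    rw [S.deriv_word_cons i w hxΩ, S.word_cons', List.length_cons, ← hp]
    have e3 : ‖(1 + δ : ℂ)‖ = 1 + δ := by
      have : (1 + δ : ℂ) = ((1 + δ : ℝ) : ℂ) := by push_cast; rfl
      rw [this, Complex.norm_real, Real.norm_of_nonneg (by positivity)]
    rw [norm_mul, norm_mul, e3] at hψG
    rw [norm_mul, pow_succ]
    refine le_trans (le_of_eq ?_) hψG
    ring

lemma deriv_decay (S : HolIFS) : ∃ θ D : ℝ, 0 < θ ∧ θ < 1 ∧ 0 < D ∧
    ∀ (w : List (Fin S.m)) (x : ℂ) (r : ℝ), 0 < r → closedBall x r ⊆ S.Ω →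
      ‖deriv (S.word w) x‖ ≤ D / r * θ ^ w.length := by
  obtain ⟨δ, hδ, h⟩ := S.exists_delta
  obtain ⟨D, hD0, hD⟩ := S.hbdd.exists_pos_norm_le
  refine ⟨(1 + δ)⁻¹, D, by positivity, inv_lt_one_of_one_lt₀ (by linarith), hD0, ?_⟩
  intro w x r hr hx
  have hψ : ∀ z : ℂ, HasDerivAt (fun z => z / (D:ℂ)) (1 / D) z := fun z => (hasDerivAt_id z).div_const _
  have := S.schwarz_word hδ h w (fun z => z / D)
    (fun z _ => (hψ z).differentiableAt.differentiableWithinAt) (fun z hz => by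
      rw [norm_div, Complex.norm_real, Real.norm_of_nonneg hD0.le, div_le_one hD0]; exact hD z hz) x r hr hx
  rw [(hψ _).deriv, norm_div, Complex.norm_real, Real.norm_of_nonneg hD0.le, norm_one] at this
  rw [inv_pow, ← div_eq_mul_inv, le_div_iff₀ (by positivity)]
  have h2 := mul_le_mul_of_nonneg_left this hD0.le
  calc _ = D * (1 / D * ‖deriv (S.word w) x‖ * (1 + δ) ^ w.length) := by field_simp
    _ ≤ _ := h2
    _ = _ := by ring

end HolIFS

lemma aux_chain {ι : Type*} {Ω : Set ℂ} (hΩ : IsOpen Ω) (hc : IsPreconnected Ω) (u : ι → ℂ → ℂ)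
    (M : ι → ℝ) (hM : ∀ a, 0 ≤ M a) (hd : ∀ a, DifferentiableOn ℂ (u a) Ω)
    (hb : ∀ L ⊆ Ω, IsCompact L → ∃ C : ℝ, ∀ a, ∀ z ∈ L, ‖deriv (u a) z‖ ≤ C * M a)
    {L : Set ℂ} (hL : IsCompact L) (hLΩ : L ⊆ Ω) :
    ∃ C : ℝ, 0 ≤ C ∧ ∀ a, ∀ x ∈ L, ∀ y ∈ L, ‖u a x - u a y‖ ≤ C * M a := by
  have hloc : ∀ z ∈ Ω, ∃ ε > 0, ∃ C : ℝ, 0 ≤ C ∧ ball z ε ⊆ Ω ∧ ∀ a, ∀ y ∈ ball z ε, ‖u a y - u a z‖ ≤ C * M a := by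
    intro z hz
    obtain ⟨ε, hε, hεΩ⟩ := Metric.nhds_basis_closedBall.mem_iff.1 (hΩ.mem_nhds hz)
    obtain ⟨C, hC⟩ := hb _ hεΩ (isCompact_closedBall z ε)
    refine ⟨ε, hε, |C| * ε, by positivity, ball_subset_closedBall.trans hεΩ, fun a y hy => ?_⟩
    have := Convex.norm_image_sub_le_of_norm_deriv_le (f := u a) (C := C * M a) (s := closedBall z ε)
      (fun x hx => (hd a).differentiableAt (hΩ.mem_nhds (hεΩ hx))) (fun x hx => hC a x hx)
      (convex_closedBall z ε) (mem_closedBall_self hε.le) (ball_subset_closedBall hy)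
    refine this.trans ?_
    have h1 : ‖y - z‖ ≤ ε := by rw [← dist_eq_norm]; exact (mem_ball.1 hy).le
    have h2 : C * M a ≤ |C| * M a := mul_le_mul_of_nonneg_right (le_abs_self C) (hM a)
    calc _ ≤ |C| * M a * ε := mul_le_mul h2 h1 (norm_nonneg _) (mul_nonneg (abs_nonneg _) (hM a))
      _ = _ := by ring
  have hP : ∀ x ∈ Ω, ∀ y ∈ Ω, ∃ C : ℝ, 0 ≤ C ∧ ∀ a, ‖u a x - u a y‖ ≤ C * M a := by
    intro x hx y hy
    refine hc.induction₂ (fun x y => ∃ C : ℝ, 0 ≤ C ∧ ∀ a, ‖u a x - u a y‖ ≤ C * M a) ?_ ?_ ?_ hx hy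
    · intro z hz
      obtain ⟨ε, hε, C, hC0, -, hC⟩ := hloc z hz
      filter_upwards [nhdsWithin_le_nhds (ball_mem_nhds z hε)] with y hy
      exact ⟨C, hC0, fun a => by rw [norm_sub_rev]; exact hC a y hy⟩
    · rintro x y z - - - ⟨C1, h10, h1⟩ ⟨C2, h20, h2⟩
      refine ⟨C1 + C2, by positivity, fun a => ?_⟩
      calc _ ≤ _ := norm_sub_le_norm_sub_add_norm_sub (u a x) (u a y) (u a z)
        _ ≤ C1 * M a + C2 * M a := add_le_add (h1 a) (h2 a)
        _ = _ := by ring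
    · rintro x y - - ⟨C1, h10, h1⟩
      exact ⟨C1, h10, fun a => by rw [norm_sub_rev]; exact h1 a⟩
  rcases L.eq_empty_or_nonempty with rfl | ⟨x0, hx0⟩
  · exact ⟨0, le_rfl, by simp⟩
  have hx0Ω := hLΩ hx0
  obtain ⟨C, hC0, hC⟩ : ∃ C : ℝ, 0 ≤ C ∧ ∀ a, ∀ y ∈ L, ‖u a y - u a x0‖ ≤ C * M a := by
    refine hL.induction_on (p := fun s => ∃ C : ℝ, 0 ≤ C ∧ ∀ a, ∀ y ∈ s, ‖u a y - u a x0‖ ≤ C * M a) ?_ ?_ ?_ ?_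
    · exact ⟨0, le_rfl, by simp⟩
    · rintro s t hst ⟨C, hC0, hC⟩
      exact ⟨C, hC0, fun a y hy => hC a y (hst hy)⟩
    · rintro s t ⟨C1, h10, h1⟩ ⟨C2, h20, h2⟩
      refine ⟨max C1 C2, by positivity, fun a y hy => ?_⟩
      rcases hy with hy | hy
      · exact (h1 a y hy).trans (mul_le_mul_of_nonneg_right (le_max_left _ _) (hM a))
      · exact (h2 a y hy).trans (mul_le_mul_of_nonneg_right (le_max_right _ _) (hM a))
    · intro z hz
      obtain ⟨ε, hε, C, hC0, -, hC⟩ := hloc z (hLΩ hz)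
      obtain ⟨C', hC0', hC'⟩ := hP z (hLΩ hz) x0 hx0Ω
      refine ⟨ball z ε, nhdsWithin_le_nhds (ball_mem_nhds z hε), C + C', by positivity, fun a y hy => ?_⟩
      calc _ ≤ _ := norm_sub_le_norm_sub_add_norm_sub (u a y) (u a z) (u a x0)
        _ ≤ C * M a + C' * M a := add_le_add (hC a y hy) (hC' a)
        _ = _ := by ring
  refine ⟨C + C, by positivity, fun a x hx y hy => ?_⟩
  calc _ ≤ _ := norm_sub_le_norm_sub_add_norm_sub (u a x) (u a x0) (u a y)
    _ ≤ C * M a + C * M a := add_le_add (hC a x hx) (by rw [norm_sub_rev]; exact hC a y hy)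
    _ = _ := by ring

lemma aux_cthick {K Ω : Set ℂ} (hK : IsCompact K) (hΩ : IsOpen Ω) (h : K ⊆ Ω) :
    ∃ r : ℝ, 0 < r ∧ IsCompact (cthickening r K) ∧ cthickening r K ⊆ Ω ∧
      ∀ x ∈ K, closedBall x r ⊆ cthickening r K := by
  obtain ⟨r, hr, hr2⟩ := hK.exists_cthickening_subset_open hΩ h
  exact ⟨r, hr, hK.cthickening, hr2, fun x hx => closedBall_subset_cthickening hx r⟩

namespace HolIFS

lemma contract (S : HolIFS) : ∃ θ : ℝ, 0 < θ ∧ θ < 1 ∧ ∀ L ⊆ S.Ω, IsCompact L → ∃ C : ℝ, 0 ≤ C ∧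
    ∀ w : List (Fin S.m), (∀ x ∈ L, ‖deriv (S.word w) x‖ ≤ C * θ ^ w.length) ∧
      ∀ x ∈ L, ∀ y ∈ L, ‖S.word w x - S.word w y‖ ≤ C * θ ^ w.length := by
  obtain ⟨θ, D, h0, h1, hD, h⟩ := S.deriv_decay
  have hder : ∀ L ⊆ S.Ω, IsCompact L → ∃ C : ℝ, ∀ w : List (Fin S.m),
      ∀ x ∈ L, ‖deriv (S.word w) x‖ ≤ C * θ ^ w.length := by
    intro L hL hLc
    obtain ⟨r, hr, -, hr2, hr3⟩ := aux_cthick hLc S.hopen hL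
    exact ⟨D / r, fun w x hx => h w x r hr ((hr3 x hx).trans hr2)⟩
  refine ⟨θ, h0, h1, fun L hL hLc => ?_⟩
  obtain ⟨C1, hC1⟩ := hder L hL hLc
  obtain ⟨C2, hC20, hC2⟩ := aux_chain S.hopen S.hconn.isPreconnected (fun w => S.word w)
    (fun w => θ ^ w.length) (fun w => by positivity) (fun w => S.word_diff w) hder hLc hL
  refine ⟨max C1 C2, by positivity, fun w => ⟨fun x hx => (hC1 w x hx).trans ?_,
    fun x hx y hy => (hC2 w x hx y hy).trans ?_⟩⟩
  · gcongr; exact le_max_left _ _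
  · gcongr; exact le_max_right _ _

lemma deriv_g_lip (S : HolIFS) {L : Set ℂ} (hL : L ⊆ S.Ω) (hLc : IsCompact L) :
    ∃ M : ℝ, 0 ≤ M ∧ ∀ i, ∀ x ∈ L, ∀ y ∈ L,
      ‖deriv (S.g i) x‖ ≤ ‖deriv (S.g i) y‖ * Real.exp (M * ‖x - y‖) := by
  have h1 : ∀ i, ∃ M : ℝ, 0 ≤ M ∧ ∀ x ∈ L, ∀ y ∈ L,
      ‖deriv (S.g i) x‖ ≤ ‖deriv (S.g i) y‖ * Real.exp (M * ‖x - y‖) := by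
    intro i
    rcases L.eq_empty_or_nonempty with rfl | hne
    · exact ⟨0, le_rfl, by simp⟩
    have hd : DifferentiableOn ℂ (deriv (S.g i)) S.Ω := (S.hdiff i).deriv S.hopen
    obtain ⟨k, hk⟩ : ∃ K, LipschitzOnWith K (deriv (S.g i)) L := by
      apply LocallyLipschitzOn.exists_lipschitzOnWith_of_compact hLc
      intro x hx
      have ha : ContDiffAt ℂ 1 (deriv (S.g i)) x :=
        (hd.analyticAt (S.hopen.mem_nhds (hL hx))).contDiffAt
      obtain ⟨K, t, ht, hK⟩ := ha.exists_lipschitzOnWith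
      exact ⟨K, t, nhdsWithin_le_nhds ht, hK⟩
    obtain ⟨x0, hx0, hmin⟩ := hLc.exists_isMinOn hne (hd.continuousOn.mono hL).norm
    have hm : 0 < ‖deriv (S.g i) x0‖ :=
      norm_pos_iff.2 (aux_deriv_ne_zero S.hopen (S.hdiff i) (S.hinj i) (hL hx0))
    refine ⟨k / ‖deriv (S.g i) x0‖, by positivity, fun x hx y hy => ?_⟩
    have e1 : ‖deriv (S.g i) x - deriv (S.g i) y‖ ≤ k * ‖x - y‖ := hk.norm_sub_le hx hy
    have e2 : ‖deriv (S.g i) x0‖ ≤ ‖deriv (S.g i) y‖ := hmin hy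
    have e3 : ‖deriv (S.g i) x‖ ≤ ‖deriv (S.g i) y‖ + k * ‖x - y‖ := by
      have := norm_le_norm_add_norm_sub' (deriv (S.g i) x) (deriv (S.g i) y)
      linarith
    have e4 : k / ‖deriv (S.g i) x0‖ * ‖x - y‖ + 1 ≤ Real.exp (k / ‖deriv (S.g i) x0‖ * ‖x - y‖) :=
      Real.add_one_le_exp _
    refine e3.trans (le_trans ?_ (mul_le_mul_of_nonneg_left e4 (norm_nonneg _)))
    have e5 : k * ‖x - y‖ = ‖deriv (S.g i) x0‖ * (k / ‖deriv (S.g i) x0‖ * ‖x - y‖) := by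
      field_simp
    have e6 : ‖deriv (S.g i) x0‖ * (k / ‖deriv (S.g i) x0‖ * ‖x - y‖) ≤
      ‖deriv (S.g i) y‖ * (k / ‖deriv (S.g i) x0‖ * ‖x - y‖) := by gcongr
    linarith
  choose M hM0 hM using h1
  refine ⟨∑ i, M i, Finset.sum_nonneg fun i _ => hM0 i, fun i x hx y hy => (hM i x hx y hy).trans ?_⟩
  gcongr
  exact Finset.single_le_sum (fun i _ => hM0 i) (Finset.mem_univ i)

lemma distortion (S : HolIFS) {L : Set ℂ} (hL : L ⊆ S.Ω) (hLc : IsCompact L) :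
    ∃ C : ℝ, 0 < C ∧ ∀ w : List (Fin S.m), ∀ x ∈ L, ∀ y ∈ L,
      ‖deriv (S.word w) x‖ ≤ C * ‖deriv (S.word w) y‖ := by
  obtain ⟨K, hK, hKΩ, hgK⟩ := S.exists_core
  have hL'Ω : L ∪ K ⊆ S.Ω := union_subset hL hKΩ
  have hL'c : IsCompact (L ∪ K) := hLc.union hK
  have hinv : ∀ w : List (Fin S.m), ∀ x ∈ L ∪ K, S.word w x ∈ L ∪ K := by
    intro w x hx
    cases w with
    | nil => exact hx
    | cons i w => exact Or.inr (hgK i _ (S.word_mem w (hL'Ω hx)))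
  obtain ⟨θ, h0, h1, h⟩ := S.contract
  obtain ⟨C, hC0, hC⟩ := h _ hL'Ω hL'c
  obtain ⟨M, hM0, hM⟩ := S.deriv_g_lip hL'Ω hL'c
  have key : ∀ w : List (Fin S.m), ∀ x ∈ L ∪ K, ∀ y ∈ L ∪ K, ‖deriv (S.word w) x‖ ≤
      ‖deriv (S.word w) y‖ * Real.exp (M * (C * ∑ j ∈ Finset.range w.length, θ ^ j)) := by
    intro w x hx y hy
    induction w with
    | nil =>
      have e : S.word [] = id := rfl
      simp [e]
    | cons i w ih =>
      rw [S.deriv_word_cons i w (hL'Ω hx), S.deriv_word_cons i w (hL'Ω hy), norm_mul, norm_mul,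
        List.length_cons, Finset.sum_range_succ]
      have e1 := hM i _ (hinv w x hx) _ (hinv w y hy)
      have e2 : M * ‖S.word w x - S.word w y‖ ≤ M * (C * θ ^ w.length) :=
        mul_le_mul_of_nonneg_left ((hC w).2 x hx y hy) hM0
      calc _ ≤ (‖deriv (S.g i) (S.word w y)‖ * Real.exp (M * (C * θ ^ w.length))) *
            (‖deriv (S.word w) y‖ * Real.exp (M * (C * ∑ j ∈ Finset.range w.length, θ ^ j))) := by
            apply mul_le_mul (e1.trans _) ih (norm_nonneg _) (by positivity)
            gcongr
        _ = _ := by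
            rw [mul_add, mul_add, Real.exp_add]; ring
  refine ⟨Real.exp (M * (C * (1 - θ)⁻¹)), Real.exp_pos _, fun w x hx y hy => ?_⟩
  refine (key w x (Or.inl hx) y (Or.inl hy)).trans ?_
  rw [mul_comm]
  gcongr
  have := (summable_geometric_of_lt_one h0.le h1).sum_le_tsum (Finset.range w.length) (fun j _ => by positivity)
  rwa [tsum_geometric_of_lt_one h0.le h1] at this

lemma osc (S : HolIFS) {x0 : ℂ} (hx0 : x0 ∈ S.Ω) {L : Set ℂ} (hL : L ⊆ S.Ω) (hLc : IsCompact L) :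
    ∃ C : ℝ, 0 ≤ C ∧ ∀ w : List (Fin S.m), ∀ x ∈ L, ∀ y ∈ L,
      ‖S.word w x - S.word w y‖ ≤ C * ‖deriv (S.word w) x0‖ := by
  refine aux_chain S.hopen S.hconn.isPreconnected (fun w => S.word w)
    (fun w => ‖deriv (S.word w) x0‖) (fun w => norm_nonneg _) (fun w => S.word_diff w) ?_ hLc hL
  intro L hL hLc
  obtain ⟨C, hC0, hC⟩ := S.distortion (L := insert x0 L) (insert_subset hx0 hL) (hLc.insert x0)
  exact ⟨C, fun w z hz => hC w z (Or.inr hz) x0 (Or.inl rfl)⟩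

lemma lower (S : HolIFS) {A : Set ℂ} (hA : A ⊆ S.Ω) (hAc : IsCompact A) :
    ∃ ρ : ℝ, 0 < ρ ∧ ∀ a ∈ A, closedBall a ρ ⊆ S.Ω ∧ ∀ w : List (Fin S.m), ∀ y ∈ closedBall a ρ,
      ‖deriv (S.word w) a‖ * ‖y - a‖ / 2 ≤ ‖S.word w y - S.word w a‖ := by
  obtain ⟨r, hr, hTc, hTΩ, hT⟩ := aux_cthick hAc S.hopen hA
  obtain ⟨C, hC0, hC⟩ := S.distortion hTΩ hTc
  set ρ := min (r / 2) (r / (4 * C)) with hρ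
  have hρ0 : 0 < ρ := by positivity
  have hρr : ρ ≤ r / 2 := min_le_left _ _
  have hρC : ρ ≤ r / (4 * C) := min_le_right _ _
  refine ⟨ρ, hρ0, fun a ha => ?_⟩
  have hball : closedBall a ρ ⊆ S.Ω :=
    (closedBall_subset_closedBall (by linarith)).trans ((hT a ha).trans hTΩ)
  refine ⟨hball, fun w y hy => ?_⟩
  set d := deriv (S.word w) a with hd
  have haT : a ∈ cthickening r A := hT a ha (mem_closedBall_self hr.le)
  have hdd : DifferentiableOn ℂ (deriv (S.word w)) S.Ω := (S.word_diff w).deriv S.hopen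
  have h2 : ∀ z ∈ closedBall a ρ, ‖deriv (deriv (S.word w)) z‖ ≤ C * ‖d‖ / (r / 2) := by
    intro z hz
    have hsub : closedBall z (r / 2) ⊆ closedBall a r :=
      closedBall_subset_closedBall' (by rw [mem_closedBall] at hz; linarith)
    refine Complex.norm_deriv_le_of_forall_mem_sphere_norm_le (by positivity)
      (hdd.diffContOnCl_ball (hsub.trans ((hT a ha).trans hTΩ))) ?_
    intro x hx
    exact hC w x (hT a ha (hsub (sphere_subset_closedBall hx))) a haT
  have h3 : ∀ z ∈ closedBall a ρ, ‖deriv (S.word w) z - d‖ ≤ ‖d‖ / 2 := by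
    intro z hz
    have := Convex.norm_image_sub_le_of_norm_deriv_le (f := deriv (S.word w))
      (fun x hx => hdd.differentiableAt (S.hopen.mem_nhds (hball hx))) h2
      (convex_closedBall a ρ) (mem_closedBall_self hρ0.le) hz
    refine this.trans ?_
    rw [mem_closedBall, dist_eq_norm] at hz
    calc _ ≤ C * ‖d‖ / (r / 2) * (r / (4 * C)) := by gcongr; exact hz.trans hρC
      _ = _ := by field_simp; norm_num
  have h4 := Convex.norm_image_sub_le_of_norm_hasDerivWithin_le (f := fun z => S.word w z - d * z)
      (f' := fun z => deriv (S.word w) z - d * 1) (C := ‖d‖ / 2) (s := closedBall a ρ)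
      (fun x hx => ((S.word_diffAt w (hball hx)).hasDerivAt.fun_sub
        ((hasDerivAt_id x).const_mul d)).hasDerivWithinAt)
      (fun z hz => by rw [mul_one]; exact h3 z hz)
      (convex_closedBall a ρ) (mem_closedBall_self hρ0.le) hy
  have h5 : ‖d * (y - a)‖ ≤ ‖S.word w y - S.word w a‖ + ‖(S.word w y - d * y) - (S.word w a - d * a)‖ := by
    have : d * (y - a) = (S.word w y - S.word w a) - ((S.word w y - d * y) - (S.word w a - d * a)) := by ring
    rw [this]; exact norm_sub_le _ _
  rw [norm_mul] at h5
  linarith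

lemma word_iter (S : HolIFS) (u : List (Fin S.m)) (n : ℕ) :
    (S.word u)^[n] = S.word (List.replicate n u).flatten := by
  induction n with
  | zero => rfl
  | succ n ih =>
    rw [Function.iterate_succ', ih, List.replicate_succ, List.flatten_cons]
    exact funext fun x => (S.word_append' _ _ x).symm

lemma len_flat {α : Type*} (u : List α) (hu : u ≠ []) (n : ℕ) :
    n ≤ (List.replicate n u).flatten.length := by
  induction n with
  | zero => simp
  | succ n ih =>
    rw [List.replicate_succ, List.flatten_cons, List.length_append]
    have := List.length_pos_iff.2 hu
    omega

lemma att_word (S : HolIFS) {A : Set ℂ} (hA : S.IsAttractor A) (w : List (Fin S.m)) {x : ℂ}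
    (hx : x ∈ A) : S.word w x ∈ A := by
  induction w with
  | nil => exact hx
  | cons i v ih => rw [hA.2.2.2]; exact mem_iUnion.2 ⟨i, mem_image_of_mem _ ih⟩

lemma iter_contract (S : HolIFS) : ∃ θ : ℝ, 0 < θ ∧ θ < 1 ∧ ∀ L ⊆ S.Ω, IsCompact L → ∃ C : ℝ, 0 ≤ C ∧
    ∀ u : List (Fin S.m), u ≠ [] → ∀ n : ℕ, (∀ x ∈ L, ‖deriv ((S.word u)^[n]) x‖ ≤ C * θ ^ n) ∧
      ∀ x ∈ L, ∀ y ∈ L, ‖(S.word u)^[n] x - (S.word u)^[n] y‖ ≤ C * θ ^ n := by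
  obtain ⟨θ, h0, h1, h⟩ := S.contract
  refine ⟨θ, h0, h1, fun L hL hLc => ?_⟩
  obtain ⟨C, hC0, hC⟩ := h L hL hLc
  refine ⟨C, hC0, fun u hu n => ?_⟩
  rw [S.word_iter]
  have : C * θ ^ (List.replicate n u).flatten.length ≤ C * θ ^ n :=
    mul_le_mul_of_nonneg_left (pow_le_pow_of_le_one h0.le h1.le (len_flat u hu n)) hC0
  exact ⟨fun x hx => ((hC _).1 x hx).trans this, fun x hx y hy => ((hC _).2 x hx y hy).trans this⟩

lemma iter_tendsto (S : HolIFS) {u : List (Fin S.m)} (hu : u ≠ []) {p : ℂ} (hp : p ∈ S.Ω)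
    (hfix : S.word u p = p) {q : ℂ} (hq : q ∈ S.Ω) :
    Tendsto (fun n => (S.word u)^[n] q) atTop (𝓝 p) := by
  obtain ⟨θ, h0, h1, h⟩ := S.iter_contract
  obtain ⟨C, hC0, hC⟩ := h {q, p} (by intro x hx; rcases hx with rfl | rfl <;> assumption)
    (Set.toFinite _).isCompact
  rw [tendsto_iff_norm_sub_tendsto_zero]
  refine squeeze_zero (g := fun n => C * θ ^ n) (fun _ => norm_nonneg _) (fun n => ?_) ?_
  · have := (hC u hu n).2 q (by simp) p (by simp)
    rwa [Function.iterate_fixed hfix] at this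
  · simpa using (tendsto_pow_atTop_nhds_zero_of_lt_one h0.le h1).const_mul C

lemma fix_unique (S : HolIFS) {u : List (Fin S.m)} (hu : u ≠ []) {p q : ℂ} (hp : p ∈ S.Ω)
    (hfix : S.word u p = p) (hq : q ∈ S.Ω) (hqf : S.word u q = q) : q = p := by
  have := S.iter_tendsto hu hp hfix hq
  simp only [Function.iterate_fixed hqf] at this
  exact tendsto_nhds_unique tendsto_const_nhds this

lemma fix_deriv (S : HolIFS) {u : List (Fin S.m)} (hu : u ≠ []) {p : ℂ} (hp : p ∈ S.Ω)
    (hfix : S.word u p = p) : ‖deriv (S.word u) p‖ < 1 := by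
  by_contra! hge
  obtain ⟨θ, h0, h1, h⟩ := S.iter_contract
  obtain ⟨C, hC0, hC⟩ := h {p} (by simpa using hp) isCompact_singleton
  have h2 : ∀ n : ℕ, 1 ≤ C * θ ^ n := by
    intro n
    have := (hC u hu n).1 p rfl
    rw [(HasDerivAt.iterate p (S.word_diffAt u hp).hasDerivAt hfix n).deriv, norm_pow] at this
    exact (one_le_pow₀ hge).trans this
  have h3 : Tendsto (fun n => C * θ ^ n) atTop (𝓝 0) := by
    simpa using (tendsto_pow_atTop_nhds_zero_of_lt_one h0.le h1).const_mul C
  have := ge_of_tendsto' h3 h2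
  linarith

lemma fix_exists (S : HolIFS) {A : Set ℂ} (hA : S.IsAttractor A) {u : List (Fin S.m)} (hu : u ≠ []) :
    ∃ p ∈ A, S.word u p = p := by
  obtain ⟨q, hq⟩ := hA.1
  have hqΩ := hA.2.2.1 hq
  obtain ⟨θ, h0, h1, h⟩ := S.iter_contract
  obtain ⟨C, hC0, hC⟩ := h {q, S.word u q}
    (by intro x hx; rcases hx with rfl | rfl; exacts [hqΩ, S.word_mem u hqΩ]) (Set.toFinite _).isCompact
  have hmem : ∀ n, (S.word u)^[n] q ∈ A := fun n => by rw [S.word_iter]; exact S.att_word hA _ hq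
  have hcs : CauchySeq (fun n => (S.word u)^[n] q) := by
    refine cauchySeq_of_le_geometric θ C h1 fun n => ?_
    rw [dist_eq_norm, Function.iterate_succ_apply]
    exact (hC u hu n).2 q (by simp) _ (by simp)
  obtain ⟨p, hp⟩ := cauchySeq_tendsto_of_complete hcs
  have hpA : p ∈ A := hA.2.1.isClosed.mem_of_tendsto hp (Eventually.of_forall hmem)
  refine ⟨p, hpA, ?_⟩
  have e1 : Tendsto (fun n => (S.word u)^[n+1] q) atTop (𝓝 (S.word u p)) := by
    simp only [Function.iterate_succ_apply']
    exact (S.word_diffAt u (hA.2.2.1 hpA)).continuousAt.tendsto.comp hp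
  exact tendsto_nhds_unique e1 (hp.comp (tendsto_add_atTop_nat 1))

end HolIFS

namespace HolIFS

lemma word_an (S : HolIFS) (w : List (Fin S.m)) {x : ℂ} (hx : x ∈ S.Ω) :
    AnalyticAt ℂ (S.word w) x := (S.word_diff w).analyticAt (S.hopen.mem_nhds hx)

lemma word_image_nhds (S : HolIFS) (w : List (Fin S.m)) {x : ℂ} (hx : x ∈ S.Ω) :
    S.word w '' S.Ω ∈ 𝓝 (S.word w x) := by
  rw [← (S.word_an w hx).hasStrictDerivAt.map_nhds_eq (S.deriv_word_ne w hx)]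
  exact image_mem_map (S.hopen.mem_nhds hx)

lemma word_image_open (S : HolIFS) (w : List (Fin S.m)) : IsOpen (S.word w '' S.Ω) := by
  rw [isOpen_iff_mem_nhds]
  rintro _ ⟨x, hx, rfl⟩
  exact S.word_image_nhds w hx

end HolIFS

lemma part_one (F : HolIFS) (A : Set ℂ) (hA : F.IsAttractor A) :
    ∀ v vt : List (Fin F.m), v ≠ [] → vt ≠ [] →
      ∀ R : ℂ → ℂ, (∀ x ∈ F.Ω, R (F.word v x) = F.word v (F.word vt x)) →
        (R '' (F.word v '' F.Ω) ⊆ F.word v '' F.Ω) ∧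
        (∃! b, b ∈ F.word v '' F.Ω ∧ R b = b) ∧
        ∀ b, b ∈ F.word v '' F.Ω → R b = b →
          ∀ l : ℕ, 1 ≤ l →
            ∃ gs : Fin l → ℂ → ℂ,
              (∀ s, IsLocalSolOn R (F.word v '' F.Ω) b l (gs s)) ∧
              (∀ s s' : Fin l, s ≠ s' → ¬ (gs s =ᶠ[nhds b] gs s')) ∧
              (∀ h : ℂ → ℂ, IsLocalSolOn R (F.word v '' F.Ω) b l h →
                ∃ s, h =ᶠ[nhds b] gs s) := by
  intro v vt hv hvt R hR
  have hfix : ∀ x ∈ F.Ω, R (F.word v x) = F.word v x → F.word vt x = x := fun x hx h =>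
    F.word_inj v (F.word_mem vt hx) hx (by rw [← hR x hx, h])
  refine ⟨?_, ?_, ?_⟩
  · rintro _ ⟨_, ⟨x, hx, rfl⟩, rfl⟩
    exact ⟨_, F.word_mem vt hx, (hR x hx).symm⟩
  · obtain ⟨p, hpA, hp⟩ := F.fix_exists hA hvt
    have hpΩ := hA.2.2.1 hpA
    refine ⟨F.word v p, ⟨mem_image_of_mem _ hpΩ, by rw [hR p hpΩ, hp]⟩, ?_⟩
    rintro _ ⟨⟨x, hx, rfl⟩, h⟩
    rw [F.fix_unique hvt hpΩ hp hx (hfix x hx h)]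
  · rintro _ ⟨a, ha, rfl⟩ hb l hl
    have hfa := hfix a ha hb
    have hev : (R ∘ F.word v) =ᶠ[𝓝 a] (F.word v ∘ F.word vt) := by
      filter_upwards [F.hopen.mem_nhds ha] with x hx using hR x hx
    have hd0 := F.deriv_word_ne v ha
    have hRan : AnalyticAt ℂ R (F.word v a) := by
      rw [← analyticAt_comp_iff_of_deriv_ne_zero (F.word_an v ha) hd0]
      refine AnalyticAt.congr ?_ hev.symm
      exact (F.word_an v (F.word_mem vt ha)).comp (F.word_an vt ha)
    have hder : deriv R (F.word v a) = deriv (F.word vt) a := by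
      have h1 := hev.deriv_eq
      rw [deriv_comp a hRan.differentiableAt (F.word_diffAt v ha),
        deriv_comp a (F.word_diffAt v (F.word_mem vt ha)) (F.word_diffAt vt ha), hfa, mul_comm] at h1
      exact mul_left_cancel₀ hd0 h1
    refine aux_roots hRan hb ?_ ?_ (F.word_image_nhds v ha) hl
    · rw [hder]; exact norm_pos_iff.2 (F.deriv_word_ne vt ha)
    · rw [hder]; exact F.fix_deriv hvt ha hfa

namespace HolIFS

lemma sep_nhds (S : HolIFS) {A : Set ℂ} (hA : S.IsAttractor A) (hS : S.SSC A) :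
    ∃ η : ℝ, 0 < η ∧ thickening η A ⊆ S.Ω ∧ ∀ z ∈ thickening η A, ∀ i, S.g i z ∈ A → z ∈ A := by
  obtain ⟨hne, hc, hAΩ, hAeq⟩ := hA
  have himc : ∀ j, IsCompact (S.g j '' A) := fun j => hc.image_of_continuousOn ((S.hdiff j).continuousOn.mono hAΩ)
  set W : Set ℂ := ⋂ i, (S.Ω ∩ S.g i ⁻¹' (⋃ j ∈ {j | j ≠ i}, S.g j '' A)ᶜ) with hW
  have hWo : IsOpen W := by
    refine isOpen_iInter_of_finite fun i => ?_
    refine (S.hdiff i).continuousOn.isOpen_inter_preimage S.hopen ?_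
    rw [isOpen_compl_iff]
    exact (Set.toFinite {j | j ≠ i}).isClosed_biUnion fun j _ => (himc j).isClosed
  have hAW : A ⊆ W := by
    intro z hz
    refine mem_iInter.2 fun i => ⟨hAΩ hz, ?_⟩
    intro hmem
    simp only [mem_iUnion] at hmem
    obtain ⟨j, hj, hmem⟩ := hmem
    exact (Set.disjoint_left.1 (hS j i hj)) hmem (mem_image_of_mem _ hz)
  obtain ⟨η, hη, hth⟩ := hc.exists_thickening_subset_open hWo hAW
  refine ⟨η, hη, fun z hz => (mem_iInter.1 (hth hz) ⟨0, S.hm⟩).1, fun z hz i hi => ?_⟩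
  have h1 := mem_iInter.1 (hth hz) i
  rw [hAeq] at hi
  obtain ⟨j, hj⟩ := mem_iUnion.1 hi
  by_cases hji : j = i
  · subst hji
    obtain ⟨a, ha, hae⟩ := hj
    rw [← S.hinj j (hAΩ ha) h1.1 hae]; exact ha
  · exact absurd (mem_biUnion (show j ∈ {j | j ≠ i} from hji) hj) h1.2

lemma back (S : HolIFS) {A : Set ℂ} (hA : S.IsAttractor A) (hS : S.SSC A) :
    ∃ ρ : ℝ, 0 < ρ ∧ ∀ a ∈ A, closedBall a ρ ⊆ S.Ω ∧ ∀ w, ∀ y ∈ closedBall a ρ, S.word w y ∈ A → y ∈ A := by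
  obtain ⟨η, hη, hηΩ, hb⟩ := S.sep_nhds hA hS
  obtain ⟨r, hr, hTc, hTΩ, hT⟩ := aux_cthick hA.2.1 S.hopen hA.2.2.1
  obtain ⟨θ, h0, h1, h⟩ := S.contract
  obtain ⟨C, hC0, hC⟩ := h _ hTΩ hTc
  refine ⟨min r (η / (C + 1) / 2), by positivity, fun a ha => ?_⟩
  have hsub : closedBall a (min r (η / (C + 1) / 2)) ⊆ closedBall a r :=
    closedBall_subset_closedBall (min_le_left _ _)
  refine ⟨(hsub.trans (hT a ha)).trans hTΩ, fun w y hy => ?_⟩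
  have hth : ∀ s, S.word s y ∈ thickening η A := by
    intro s
    rw [mem_thickening_iff]
    refine ⟨S.word s a, S.att_word hA s ha, ?_⟩
    have := Convex.norm_image_sub_le_of_norm_deriv_le (f := S.word s) (C := C)
      (fun x hx => S.word_diffAt s (hTΩ (hT a ha hx)))
      (fun x hx => ((hC s).1 x (hT a ha hx)).trans
        (mul_le_of_le_one_right hC0 (pow_le_one₀ h0.le h1.le)))
      (convex_closedBall a r) (mem_closedBall_self hr.le) (hsub hy)
    rw [dist_eq_norm]
    refine this.trans_lt ?_
    have h2 : ‖y - a‖ ≤ η / (C + 1) / 2 := by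
      rw [mem_closedBall, dist_eq_norm] at hy; exact hy.trans (min_le_right _ _)
    calc C * ‖y - a‖ ≤ (C + 1) * (η / (C + 1) / 2) := by gcongr; linarith
      _ = η / 2 := by field_simp
      _ < η := by linarith
  induction w with
  | nil => exact fun h => h
  | cons i w ih => exact fun h => ih (hb _ (hth w) i h)

lemma good_word (S : HolIFS) {A : Set ℂ} (hA : S.IsAttractor A) {x0 : ℂ} (hx0 : x0 ∈ A) :
    ∃ C : ℝ, 0 < C ∧ ∀ t : ℝ, 0 < t → t ≤ 1 → ∀ x ∈ A, ∃ (u : List (Fin S.m)) (a : ℂ), a ∈ A ∧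
      S.word u a = x ∧ t ≤ ‖deriv (S.word u) x0‖ ∧ ‖deriv (S.word u) x0‖ ≤ C * t := by
  have hAΩ := hA.2.2.1
  obtain ⟨C1, hC10, hC1⟩ := S.distortion hAΩ hA.2.1
  have hm : ∃ m : ℝ, 0 < m ∧ ∀ i, m ≤ ‖deriv (S.g i) x0‖ := by
    have : Nonempty (Fin S.m) := ⟨⟨0, S.hm⟩⟩
    obtain ⟨i0, hi0⟩ := Finite.exists_min (fun i => ‖deriv (S.g i) x0‖)
    exact ⟨_, norm_pos_iff.2 (aux_deriv_ne_zero S.hopen (S.hdiff i0) (S.hinj i0) (hAΩ hx0)), hi0⟩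
  obtain ⟨m, hm0, hm⟩ := hm
  refine ⟨C1 / m, by positivity, fun t ht ht1 x hx => ?_⟩
  by_contra! hno
  have hstep : ∀ n : ℕ, ∃ (u : List (Fin S.m)) (a : ℂ), u.length = n ∧ a ∈ A ∧ S.word u a = x ∧
      t ≤ ‖deriv (S.word u) x0‖ := by
    intro n
    induction n with
    | zero =>
      refine ⟨[], x, rfl, hx, rfl, ?_⟩
      have e : S.word [] = id := rfl
      simpa [e] using ht1
    | succ n ih =>
      obtain ⟨u, a, hu, ha, hua, htu⟩ := ih
      have h1 := hno u a ha hua htu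
      have ha' := ha
      rw [hA.2.2.2] at ha'
      obtain ⟨i, a', ha'A, rfl⟩ := mem_iUnion.1 ha'
      refine ⟨u ++ [i], a', by simp [hu], ha'A, by rw [S.word_append']; exact hua, ?_⟩
      rw [S.deriv_word_append u [i] (hAΩ hx0), norm_mul]
      have h2 : ‖deriv (S.word u) x0‖ ≤ C1 * ‖deriv (S.word u) (S.word [i] x0)‖ :=
        hC1 u x0 hx0 _ (S.att_word hA [i] hx0)
      have e3 : S.word [i] = S.g i := rfl
      have h3 : m ≤ ‖deriv (S.word [i]) x0‖ := by rw [e3]; exact hm i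
      have h4 : C1 * t ≤ C1 * ‖deriv (S.word u) (S.word [i] x0)‖ * m := by
        rw [div_mul_eq_mul_div, div_lt_iff₀ hm0] at h1
        exact h1.le.trans (mul_le_mul_of_nonneg_right h2 hm0.le)
      have h5 : t ≤ ‖deriv (S.word u) (S.word [i] x0)‖ * m := by
        rw [mul_assoc] at h4; exact le_of_mul_le_mul_left h4 hC10
      exact h5.trans (mul_le_mul_of_nonneg_left h3 (norm_nonneg _))
  obtain ⟨θ, h0, h1, h⟩ := S.contract
  obtain ⟨C, hC0, hC⟩ := h A hAΩ hA.2.1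
  have h2 : ∀ n : ℕ, t ≤ C * θ ^ n := by
    intro n
    obtain ⟨u, a, hu, -, -, htu⟩ := hstep n
    rw [← hu]
    exact htu.trans ((hC u).1 x0 hx0)
  have h3 : Tendsto (fun n => C * θ ^ n) atTop (𝓝 0) := by
    simpa using (tendsto_pow_atTop_nhds_zero_of_lt_one h0.le h1).const_mul C
  have := ge_of_tendsto' h3 h2
  linarith

lemma core_vanish (F : HolIFS) {A : Set ℂ} (hA : F.IsAttractor A) {x0 : ℂ} (hx0 : x0 ∈ A)
    {ρ c r : ℝ} (hρ : 0 < ρ) (hc : 0 < c) (hr : 0 < r) (hρΩ : ∀ a ∈ A, closedBall a ρ ⊆ F.Ω)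
    (hrΩ : ball x0 r ⊆ F.Ω) :
    ∃ ε : ℝ, 0 < ε ∧ ∀ H1 H2 : ℂ → ℂ, DifferentiableOn ℂ H1 F.Ω → DifferentiableOn ℂ H2 F.Ω →
      InjOn H1 F.Ω →
      (∀ u, ∀ a ∈ A, ∀ y ∈ sphere a ρ, c * ‖deriv (F.word u) x0‖ ≤ ‖H1 (F.word u y) - H1 (F.word u a)‖) →
      (∀ z ∈ A, ∀ u, ∀ a ∈ A, ∀ y ∈ closedBall a ρ, H1 (F.word u y) = H2 z → y ∈ A) →
      (∀ z ∈ ball x0 r, ‖H2 z - H1 z‖ < ε) →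
      (∀ z ∈ ball x0 r, ‖deriv (fun z => H2 z - H1 z) z‖ ≤ ε) →
      ∀ x ∈ A, x ∈ ball x0 (r / 2) → H2 x - H1 x = 0 := by
  have hAΩ := hA.2.2.1
  obtain ⟨C, hC0, hC⟩ := F.good_word hA hx0
  obtain ⟨C2, hC20, hC2⟩ := F.osc (hAΩ hx0) hAΩ hA.2.1
  set B := C2 * (C * (4 / c)) + 1 with hB
  have hB0 : 0 < B := by positivity
  refine ⟨min (c / 4) (min (r / 2 / B) (1 / (2 * B))), by positivity, ?_⟩
  set ε := min (c / 4) (min (r / 2 / B) (1 / (2 * B))) with hε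
  have hε1 : ε ≤ c / 4 := min_le_left _ _
  have hε2 : ε ≤ r / 2 / B := (min_le_right _ _).trans (min_le_left _ _)
  have hε3 : ε ≤ 1 / (2 * B) := (min_le_right _ _).trans (min_le_right _ _)
  have hε0 : 0 < ε := by positivity
  intro H1 H2 hd1 hd2 hinj hlow hback hcl hcl' x hxA hxr
  by_contra hne
  set d : ℂ → ℂ := fun z => H2 z - H1 z with hd
  have hdd : DifferentiableOn ℂ d F.Ω := hd2.sub hd1
  set τ := ‖d x‖ with hτ
  have hτ0 : 0 < τ := norm_pos_iff.2 hne
  have hxr' : x ∈ ball x0 r := ball_subset_ball (by linarith) hxr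
  have hτε : τ < ε := hcl x hxr'
  have ht0 : 0 < 4 / c * τ := by positivity
  have ht1 : 4 / c * τ ≤ 1 := by
    rw [div_mul_eq_mul_div, div_le_one hc]; linarith
  obtain ⟨u, a, ha, hua, hu1, hu2⟩ := hC _ ht0 ht1 x hxA
  have hdist : ∀ a' ∈ A, ‖F.word u a' - x‖ ≤ B * τ := by
    intro a' ha'
    rw [← hua]
    refine (hC2 u a' ha' a ha).trans ?_
    calc C2 * ‖deriv (F.word u) x0‖ ≤ C2 * (C * (4 / c * τ)) := by gcongr
      _ = (B - 1) * τ := by rw [hB]; ring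
      _ ≤ B * τ := by nlinarith
  have hPball : ∀ a' ∈ A, F.word u a' ∈ ball x0 r := by
    intro a' ha'
    have h1 := hdist a' ha'
    have h2 : B * τ < r / 2 := by
      calc B * τ < B * ε := by gcongr
        _ ≤ B * (r / 2 / B) := by gcongr
        _ = r / 2 := by field_simp
    rw [mem_ball] at hxr ⊢
    rw [← dist_eq_norm] at h1
    linarith [dist_triangle (F.word u a') x x0]
  have hdP : ∀ a' ∈ A, ‖d (F.word u a') - d x‖ ≤ τ / 2 := by
    intro a' ha'
    have := Convex.norm_image_sub_le_of_norm_deriv_le (f := d) (C := ε)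
      (fun z hz => hdd.differentiableAt (F.hopen.mem_nhds (hrΩ hz))) hcl'
      (convex_ball x0 r) hxr' (hPball a' ha')
    refine this.trans ?_
    calc ε * ‖F.word u a' - x‖ ≤ 1 / (2 * B) * (B * τ) := by gcongr; exact hdist a' ha'
      _ = τ / 2 := by field_simp
  have hwA : ∀ a' ∈ A, F.word u a' ∈ F.Ω := fun a' ha' => F.word_mem u (hAΩ ha')
  obtain ⟨a0, ha0, hmax⟩ := hA.2.1.exists_isMaxOn hA.1
    (f := fun a' => (starRingEnd ℂ (d x) * H1 (F.word u a')).re) (by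
      refine Complex.continuous_re.comp_continuousOn (continuousOn_const.mul ?_)
      exact hd1.continuousOn.comp ((F.word_diff u).continuousOn.mono hAΩ) hwA)
  have hcomp : DifferentiableOn ℂ (fun y => H1 (F.word u y)) F.Ω :=
    hd1.comp (F.word_diff u) (fun x hx => F.word_mem u hx)
  have hsub := (hcomp.diffContOnCl_ball (hρΩ a0 ha0)).ball_subset_image_closedBall hρ
    (fun y hy => hlow u a0 ha0 y hy) (by
      have h1 : ∀ᶠ y in 𝓝[≠] a0, H1 (F.word u y) ≠ H1 (F.word u a0) := by
        filter_upwards [self_mem_nhdsWithin, nhdsWithin_le_nhds (F.hopen.mem_nhds (hAΩ ha0))] with y hy hyΩ he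
        exact hy (F.word_inj u hyΩ (hAΩ ha0) (hinj (F.word_mem u hyΩ) (hwA a0 ha0) he))
      exact h1.frequently.filter_mono nhdsWithin_le_nhds)
  have he : H2 (F.word u a0) ∈ ball (H1 (F.word u a0)) (c * ‖deriv (F.word u) x0‖ / 2) := by
    rw [mem_ball, dist_eq_norm]
    have h1 : ‖d (F.word u a0)‖ ≤ τ + τ / 2 := by
      have := norm_le_norm_add_norm_sub' (d (F.word u a0)) (d x)
      linarith [hdP a0 ha0]
    have h2 : 4 * τ ≤ c * ‖deriv (F.word u) x0‖ := by
      calc 4 * τ = c * (4 / c * τ) := by field_simp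
        _ ≤ _ := by gcongr
    change ‖d (F.word u a0)‖ < _
    linarith
  obtain ⟨y, hy, hye⟩ := hsub he
  have hyA : y ∈ A := hback _ (F.att_word hA u ha0) u a0 ha0 y hy hye
  have h1 := hmax hyA
  simp only [mem_ofPred_eq] at h1
  have hye' : H1 (F.word u y) = H1 (F.word u a0) + d (F.word u a0) := by
    rw [show H1 (F.word u y) = H2 (F.word u a0) from hye]; simp [hd]
  rw [hye', mul_add, Complex.add_re] at h1
  have h2 : (starRingEnd ℂ (d x) * d (F.word u a0)).re ≤ 0 := by linarith
  have h3 : starRingEnd ℂ (d x) * d (F.word u a0) = ((τ ^ 2 : ℝ) : ℂ) +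
      starRingEnd ℂ (d x) * (d (F.word u a0) - d x) := by
    have : ((τ ^ 2 : ℝ) : ℂ) = starRingEnd ℂ (d x) * d x := by
      rw [Complex.conj_mul', hτ]; push_cast; rfl
    rw [this]; ring
  rw [h3, Complex.add_re, Complex.ofReal_re] at h2
  have h4 : |(starRingEnd ℂ (d x) * (d (F.word u a0) - d x)).re| ≤ τ * (τ / 2) := by
    refine (Complex.abs_re_le_norm _).trans ?_
    rw [norm_mul, RCLike.norm_conj]
    exact mul_le_mul_of_nonneg_left (hdP a0 ha0) (norm_nonneg _)
  have h5 := neg_abs_le (starRingEnd ℂ (d x) * (d (F.word u a0) - d x)).re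
  nlinarith

end HolIFS

lemma aux_montel {Ω : Set ℂ} (hΩ : IsOpen Ω) {x0 : ℂ} {r B : ℝ} (hr : 0 < r) (hB : 0 < B)
    (hsub : closedBall x0 r ⊆ Ω) (H : ℕ → ℂ → ℂ) (hd : ∀ k, DifferentiableOn ℂ (H k) Ω)
    (hb : ∀ k, ∀ z ∈ closedBall x0 r, ‖H k z‖ ≤ B) {ε : ℝ} (hε : 0 < ε) :
    ∃ j k, j < k ∧ (∀ z ∈ ball x0 (r / 4), ‖H k z - H j z‖ < ε) ∧
      ∀ z ∈ ball x0 (r / 4), ‖deriv (fun z => H k z - H j z) z‖ ≤ ε := by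
  have hder : ∀ k, ∀ z ∈ closedBall x0 (r / 2), ‖deriv (H k) z‖ ≤ B / (r / 2) := by
    intro k z hz
    have hs : closedBall z (r / 2) ⊆ closedBall x0 r :=
      closedBall_subset_closedBall' (by rw [mem_closedBall] at hz; linarith)
    refine Complex.norm_deriv_le_of_forall_mem_sphere_norm_le (by positivity)
      ((hd k).diffContOnCl_ball (hs.trans hsub)) fun w hw => hb k w (hs (sphere_subset_closedBall hw))
  have hsub2 : closedBall x0 (r / 2) ⊆ closedBall x0 r := closedBall_subset_closedBall (by linarith)
  have hlip : ∀ k, ∀ x ∈ closedBall x0 (r / 2), ∀ y ∈ closedBall x0 (r / 2),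
      ‖H k y - H k x‖ ≤ B / (r / 2) * ‖y - x‖ := fun k x hx y hy =>
    Convex.norm_image_sub_le_of_norm_deriv_le
      (fun z hz => (hd k).differentiableAt (hΩ.mem_nhds (hsub (hsub2 hz)))) (hder k)
      (convex_closedBall x0 (r / 2)) hx hy
  set M := B / (r / 2) with hM
  have hM0 : 0 < M := by positivity
  set e := min ε (ε * (r / 4)) with he
  have he0 : 0 < e := by positivity
  set δ := e / (8 * M) with hδ
  have hδ0 : 0 < δ := by positivity
  obtain ⟨T, hTs, hTf, hTc⟩ := (isCompact_closedBall x0 (r / 2)).finite_cover_balls hδ0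
  have : Fintype T := hTf.fintype
  obtain ⟨l, -, ψ, hψ, hl⟩ := tendsto_subseq_of_bounded (isBounded_closedBall (x := (0 : T → ℂ)) (r := B))
    (x := fun k (t : T) => H k t) (fun k => by
      rw [mem_closedBall_zero_iff, pi_norm_le_iff_of_nonneg hB.le]
      exact fun t => hb k t (hsub2 (hTs t.2)))
  obtain ⟨n, hn⟩ := Metric.cauchySeq_iff.1 hl.cauchySeq (e / 8) (by positivity)
  have h1 := hn (n + 1) (by omega) n le_rfl
  rw [dist_pi_lt_iff (by positivity)] at h1
  set j := ψ n
  set k := ψ (n + 1)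
  have hjk : j < k := hψ (Nat.lt_succ_self n)
  have hclose : ∀ z ∈ closedBall x0 (r / 2), ‖H k z - H j z‖ < e / 2 := by
    intro z hz
    have hz' := hTc hz
    simp only [mem_iUnion] at hz'
    obtain ⟨t, htT, hzt⟩ := hz'
    rw [mem_ball, dist_eq_norm] at hzt
    have h2 : ‖H k t - H j t‖ < e / 8 := by
      have := h1 ⟨t, htT⟩
      rwa [dist_eq_norm] at this
    have h3 := hlip k t (hTs htT) z hz
    have h4 := hlip j t (hTs htT) z hz
    have h5 : M * ‖z - t‖ ≤ e / 8 := by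
      calc M * ‖z - t‖ ≤ M * δ := by gcongr
        _ = e / 8 := by rw [hδ]; field_simp
    have h6 : H k z - H j z = (H k z - H k t) + (H k t - H j t) - (H j z - H j t) := by ring
    rw [h6]
    have h7 := norm_sub_le ((H k z - H k t) + (H k t - H j t)) (H j z - H j t)
    have h8 := norm_add_le (H k z - H k t) (H k t - H j t)
    linarith
  refine ⟨j, k, hjk, fun z hz => ?_, fun z hz => ?_⟩
  · have := hclose z (ball_subset_closedBall (ball_subset_ball (by linarith) hz))
    have h2 : e ≤ ε := min_le_left _ _
    linarith
  · have hs : closedBall z (r / 4) ⊆ closedBall x0 (r / 2) :=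
      closedBall_subset_closedBall' (by rw [mem_ball] at hz; linarith)
    have := Complex.norm_deriv_le_of_forall_mem_sphere_norm_le (f := fun z => H k z - H j z) (c := z)
      (R := r / 4) (C := e) (by positivity)
      (((hd k).fun_sub (hd j)).diffContOnCl_ball (hs.trans (hsub2.trans hsub)))
      fun w hw => (hclose w (hs (sphere_subset_closedBall hw))).le.trans (by linarith)
    refine this.trans ?_
    rw [div_le_iff₀ (by positivity)]
    exact min_le_right _ _

lemma local_G (G : HolIFS) {A : Set ℂ} (hA : G.IsAttractor A) (hS : G.SSC A) (i : Fin G.m) :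
    ∃ (b lam : ℂ) (φ : ℂ → ℂ) (r : ℝ), b ∈ A ∧ G.g i b = b ∧ 0 < r ∧ 0 < ‖lam‖ ∧ ‖lam‖ < 1 ∧
      ball b r ⊆ G.Ω ∧ DifferentiableOn ℂ φ (ball b r) ∧ φ b = 0 ∧
      (∀ p ∈ ball b r, ∀ q ∈ ball b r, ‖p - q‖ ≤ 2 * ‖φ p - φ q‖ ∧ ‖φ p - φ q‖ ≤ 2 * ‖p - q‖) ∧
      (∀ z ∈ ball b r, G.g i z ∈ ball b r ∧ φ (G.g i z) = lam * φ z ∧ (G.g i z ∈ A ↔ z ∈ A)) := by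
  obtain ⟨b, hbA, hb⟩ := G.fix_exists hA (u := [i]) (by simp)
  have hbΩ := hA.2.2.1 hbA
  have e1 : G.word [i] = G.g i := rfl
  have h1 := G.fix_deriv (u := [i]) (by simp) hbΩ hb
  have h0 := norm_pos_iff.2 (G.deriv_word_ne [i] hbΩ)
  have han := G.word_an [i] hbΩ
  rw [e1] at hb h1 h0 han
  obtain ⟨φ, hφ, hφb, hφd, hφg⟩ := aux_koenigs han hb h0 h1
  obtain ⟨s, hs1, hs2⟩ := exists_between h1
  have hcon := aux_contr han hb hs1
  obtain ⟨η, hη, hηΩ, hηA⟩ := G.sep_nhds hA hS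
  have hstr : ∀ᶠ p : ℂ × ℂ in 𝓝 (b, b), ‖φ p.1 - φ p.2 - (p.1 - p.2)‖ ≤ 1 / 2 * ‖p.1 - p.2‖ := by
    have := hφ.hasStrictDerivAt.hasStrictFDerivAt.isLittleO.def (c := 1 / 2) (by norm_num)
    filter_upwards [this] with p hp
    simpa [hφd] using hp
  rw [nhds_prod_eq] at hstr
  obtain ⟨V, hV, hVb⟩ := (eventually_prod_self_iff
    (r := fun p q => ‖φ p - φ q - (p - q)‖ ≤ 1 / 2 * ‖p - q‖)).1 hstr
  have hev : ∀ᶠ z in 𝓝 b, z ∈ V ∧ z ∈ thickening η A ∧ AnalyticAt ℂ φ z ∧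
      φ (G.g i z) = deriv (G.g i) b * φ z ∧ ‖G.g i z - b‖ ≤ s * ‖z - b‖ := by
    filter_upwards [hV, isOpen_thickening.mem_nhds (self_subset_thickening hη A hbA),
      hφ.eventually_analyticAt, hφg, hcon] with z a1 a2 a3 a4 a5 using ⟨a1, a2, a3, a4, a5⟩
  obtain ⟨r, hr, hrb⟩ := Metric.eventually_nhds_iff_ball.1 hev
  refine ⟨b, deriv (G.g i) b, φ, r, hbA, hb, hr, h0, h1, fun z hz => hηΩ (hrb z hz).2.1,
    fun z hz => (hrb z hz).2.2.1.differentiableAt.differentiableWithinAt, hφb, ?_, ?_⟩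
  · intro p hp q hq
    have h2 := hVb p (hrb p hp).1 q (hrb q hq).1
    have h3 := norm_le_norm_add_norm_sub' (p - q) (φ p - φ q)
    have h4 := norm_le_norm_add_norm_sub' (φ p - φ q) (p - q)
    rw [norm_sub_rev (p - q)] at h3
    constructor
    · linarith
    · linarith [norm_nonneg (p - q)]
  · intro z hz
    obtain ⟨-, a2, -, a4, a5⟩ := hrb z hz
    refine ⟨?_, a4, fun h => hηA z a2 i h, fun h => G.att_word hA [i] h⟩
    rw [mem_ball, dist_eq_norm] at hz ⊢
    refine a5.trans_lt (lt_of_le_of_lt ?_ hz)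
    exact mul_le_of_le_one_left (norm_nonneg _) hs2.le

lemma coding (F : HolIFS) {A : Set ℂ} (hA : F.IsAttractor A) {b : ℂ} (hb : b ∈ A) :
    ∃ (a : ℕ → ℂ) (i : ℕ → Fin F.m) (w : ℕ → List (Fin F.m)), (∀ k, a k ∈ A) ∧
      (∀ k, F.word (w k) (a k) = b) ∧ (∀ k, w (k + 1) = w k ++ [i k]) ∧ (∀ k, (w k).length = k) ∧
      ∀ j k, j < k → ∃ u, u ≠ [] ∧ w k = w j ++ u := by
  have h1 : ∀ x : A, ∃ (i : Fin F.m) (y : A), F.g i y = x := by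
    rintro ⟨x, hx⟩
    have hx' := hx
    rw [hA.2.2.2] at hx'
    obtain ⟨i, y, hy, hyx⟩ := mem_iUnion.1 hx'
    exact ⟨i, ⟨y, hy⟩, hyx⟩
  choose ι σ hσ using h1
  let a : ℕ → A := fun k => σ^[k] ⟨b, hb⟩
  let w : ℕ → List (Fin F.m) := fun k => Nat.rec [] (fun k l => l ++ [ι (a k)]) k
  have hw : ∀ k, w (k + 1) = w k ++ [ι (a k)] := fun k => rfl
  have hlen : ∀ k, (w k).length = k := by
    intro k
    induction k with
    | zero => rfl
    | succ k ih => rw [hw, List.length_append, ih]; rfl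
  refine ⟨fun k => a k, fun k => ι (a k), w, fun k => (a k).2, ?_, hw, hlen, ?_⟩
  · intro k
    induction k with
    | zero => rfl
    | succ k ih =>
      rw [hw, F.word_append']
      have e : F.word [ι (a k)] (a (k + 1)) = a k := by
        have : a (k + 1) = σ (a k) := Function.iterate_succ_apply' _ _ _
        rw [this]; exact hσ (a k)
      rw [e]; exact ih
  · intro j k hjk
    obtain ⟨u, hu⟩ : ∃ u, w k = w j ++ u := by
      induction k, hjk.le using Nat.le_induction with
      | base => exact absurd hjk (lt_irrefl _)
      | succ k hk ih =>
        rcases hk.eq_or_lt with rfl | h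
        · exact ⟨_, hw j⟩
        · obtain ⟨u, hu⟩ := ih h
          exact ⟨u ++ [ι (a k)], by rw [hw, hu, List.append_assoc]⟩
    refine ⟨u, ?_, hu⟩
    rintro rfl
    have e := congrArg List.length hu
    rw [List.append_nil, hlen, hlen] at e
    omega

lemma acc_point (F : HolIFS) {A : Set ℂ} (hA : F.IsAttractor A) (hA2 : A.Nontrivial) :
    ∃ x0 ∈ A, ∃ᶠ z in 𝓝[≠] x0, z ∈ A := by
  obtain ⟨x0, hx0, hfix⟩ := F.fix_exists hA (u := [⟨0, F.hm⟩]) (by simp)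
  have hx0Ω := hA.2.2.1 hx0
  refine ⟨x0, hx0, ?_⟩
  obtain ⟨q, hq, hqx⟩ := hA2.exists_ne x0
  have hqΩ := hA.2.2.1 hq
  have h1 := F.iter_tendsto (u := [⟨0, F.hm⟩]) (by simp) hx0Ω hfix hqΩ
  have h2 : Tendsto (fun n => (F.word [⟨0, F.hm⟩])^[n] q) atTop (𝓝[≠] x0) := by
    refine tendsto_nhdsWithin_iff.2 ⟨h1, Eventually.of_forall fun n hn => hqx ?_⟩
    rw [mem_singleton_iff, ← Function.iterate_fixed hfix n, F.word_iter] at hn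
    exact F.word_inj _ hqΩ hx0Ω hn
  refine h2.frequently (Frequently.of_forall fun n => ?_)
  rw [F.word_iter]; exact F.att_word hA _ hq

lemma transfer {A : Set ℂ} {g φ : ℂ → ℂ} {b lam : ℂ} {r : ℝ} (hl : lam ≠ 0)
    (hφ : ∀ p ∈ ball b r, ∀ q ∈ ball b r, ‖p - q‖ ≤ 2 * ‖φ p - φ q‖ ∧ ‖φ p - φ q‖ ≤ 2 * ‖p - q‖)
    (hg : ∀ z ∈ ball b r, g z ∈ ball b r ∧ φ (g z) = lam * φ z ∧ (g z ∈ A ↔ z ∈ A)) :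
    (∀ n : ℕ, ∀ u ∈ ball b r, ∀ z ∈ ball b r, φ u = lam ^ n * φ z → u = g^[n] z) ∧
    (∀ n : ℤ, ∀ u ∈ ball b r, ∀ z ∈ ball b r, φ u = lam ^ n * φ z → z ∈ A → u ∈ A) := by
  have hit : ∀ n : ℕ, ∀ z ∈ ball b r, g^[n] z ∈ ball b r ∧ φ (g^[n] z) = lam ^ n * φ z ∧
      (g^[n] z ∈ A ↔ z ∈ A) := by
    intro n z hz
    induction n with
    | zero => exact ⟨hz, by simp, Iff.rfl⟩
    | succ n ih =>
      rw [Function.iterate_succ_apply']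
      obtain ⟨h1, h2, h3⟩ := hg _ ih.1
      exact ⟨h1, by rw [h2, ih.2.1]; ring, h3.trans ih.2.2⟩
  have huniq : ∀ p ∈ ball b r, ∀ q ∈ ball b r, φ p = φ q → p = q := by
    intro p hp q hq h
    have := (hφ p hp q hq).1
    rw [h, sub_self, norm_zero, mul_zero] at this
    exact sub_eq_zero.1 (norm_le_zero_iff.1 this)
  have hn : ∀ n : ℕ, ∀ u ∈ ball b r, ∀ z ∈ ball b r, φ u = lam ^ n * φ z → u = g^[n] z :=
    fun n u hu z hz h => huniq u hu _ (hit n z hz).1 (by rw [h, (hit n z hz).2.1])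
  refine ⟨hn, fun n u hu z hz h hzA => ?_⟩
  obtain ⟨m, rfl | rfl⟩ := n.eq_nat_or_neg
  · rw [zpow_natCast] at h
    rw [hn m u hu z hz h]
    exact (hit m z hz).2.2.2 hzA
  · have h' : φ z = lam ^ m * φ u := by
      rw [h, zpow_neg, zpow_natCast, mul_inv_cancel_left₀ (pow_ne_zero _ hl)]
    have e := hn m z hz u hu h'
    rw [e] at hzA
    exact (hit m u hu).2.2.1 hzA

lemma part_two_one (F : HolIFS) (A : Set ℂ)
    (hA : F.IsAttractor A) (hA2 : A.Nontrivial) (hSSC : F.SSC A)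
    (G : HolIFS) (hGA : G.IsAttractor A) (hGS : G.SSC A) (i : Fin G.m) :
    ∃ (v vt : List (Fin F.m)) (l : ℕ), v ≠ [] ∧ vt ≠ [] ∧ 1 ≤ l ∧
          ∃ (R : ℂ → ℂ) (b : ℂ),
            (∀ x ∈ F.Ω, R (F.word v x) = F.word v (F.word vt x)) ∧
            b ∈ F.word v '' F.Ω ∧ R b = b ∧
            IsLocalSolOn R (F.word v '' F.Ω) b l (G.g i) := by
  have hAΩ := hA.2.2.1
  obtain ⟨b, lam, φ, r, hbA, hgb, hr, hl0, hl1, hrG, hφd, hφb, hφ, hg⟩ := local_G G hGA hGS i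
  have hlam : lam ≠ 0 := norm_pos_iff.1 hl0
  obtain ⟨htr1, htr2⟩ := transfer hlam hφ hg
  obtain ⟨a, ι, w, haA, hwa, hws, hwl, hpre⟩ := coding F hA hbA
  obtain ⟨x0, hx0, hacc⟩ := acc_point F hA hA2
  have hx0Ω := hAΩ hx0
  -- eventually the cylinders lie in the ball
  obtain ⟨k0, hk0⟩ : ∃ k0 : ℕ, ∀ k ≥ k0, ∀ x ∈ F.Ω, F.word (w (k + 1)) x ∈ ball b r := by
    obtain ⟨K, hK, hKΩ, hgK⟩ := F.exists_core
    obtain ⟨θ, h0, h1, h⟩ := F.contract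
    obtain ⟨C, hC0, hC⟩ := h (K ∪ A) (union_subset hKΩ hAΩ) (hK.union hA.2.1)
    have h3 : Tendsto (fun n => C * θ ^ n) atTop (𝓝 0) := by
      simpa using (tendsto_pow_atTop_nhds_zero_of_lt_one h0.le h1).const_mul C
    obtain ⟨k0, hk0⟩ := eventually_atTop.1 (h3.eventually_lt_const hr)
    refine ⟨k0, fun k hk x hx => ?_⟩
    rw [mem_ball, dist_eq_norm]
    refine lt_of_le_of_lt ?_ (hk0 k hk)
    have := (hC (w k)).2 (F.g (ι k) x) (Or.inl (hgK _ x hx)) (a k) (Or.inr (haA k))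
    rw [hwl k, hwa k] at this
    rw [hws k, F.word_append']
    exact this
  -- geometry constants
  obtain ⟨ρ1, hρ1, hlow⟩ := F.lower hAΩ hA.2.1
  obtain ⟨ρ2, hρ2, hback⟩ := F.back hA hSSC
  set ρ := min ρ1 ρ2 with hρdef
  have hρ : 0 < ρ := lt_min hρ1 hρ2
  have hsub1 : ∀ a : ℂ, closedBall a ρ ⊆ closedBall a ρ1 := fun a => closedBall_subset_closedBall (min_le_left _ _)
  have hsub2 : ∀ a : ℂ, closedBall a ρ ⊆ closedBall a ρ2 := fun a => closedBall_subset_closedBall (min_le_right _ _)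
  have hρΩ : ∀ a ∈ A, closedBall a ρ ⊆ F.Ω := fun a ha => (hsub1 a).trans (hlow a ha).1
  obtain ⟨C, hC0, hC⟩ := F.distortion hAΩ hA.2.1
  obtain ⟨r1, hr1, hr1Ω⟩ := Metric.nhds_basis_closedBall.mem_iff.1 (F.hopen.mem_nhds hx0Ω)
  obtain ⟨Co, hCo0, hCo⟩ := F.osc hx0Ω (L := closedBall x0 r1 ∪ A) (union_subset hr1Ω hAΩ)
    ((isCompact_closedBall x0 r1).union hA.2.1)
  have hc : 0 < ρ / (4 * C ^ 2) := by positivity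
  have hr4 : ball x0 (r1 / 4) ⊆ F.Ω :=
    ((ball_subset_ball (by linarith)).trans ball_subset_closedBall).trans hr1Ω
  obtain ⟨ε, hε, hcore⟩ := F.core_vanish hA hx0 hρ hc (r := r1 / 4) (by positivity) hρΩ hr4
  -- the normalised maps
  have hy1 : 1 < ‖lam‖⁻¹ := (one_lt_inv₀ hl0).2 hl1
  have hn : ∀ k, ∃ n : ℤ, 1 ≤ ‖lam ^ n‖ * ‖deriv (F.word (w k)) x0‖ ∧
      ‖lam ^ n‖ * ‖deriv (F.word (w k)) x0‖ ≤ ‖lam‖⁻¹ := by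
    intro k
    have hD : 0 < ‖deriv (F.word (w k)) x0‖ := norm_pos_iff.2 (F.deriv_word_ne _ hx0Ω)
    obtain ⟨n, hn1, hn2⟩ := exists_mem_Ico_zpow hD hy1
    have hp : 0 < ‖lam‖ ^ n := zpow_pos hl0 n
    rw [inv_zpow] at hn1 hn2
    refine ⟨n, ?_, ?_⟩
    · rw [norm_zpow]
      calc 1 = ‖lam‖ ^ n * (‖lam‖ ^ n)⁻¹ := (mul_inv_cancel₀ hp.ne').symm
        _ ≤ _ := by gcongr
    · rw [norm_zpow]
      calc _ ≤ ‖lam‖ ^ n * (‖lam‖ ^ (n + 1))⁻¹ := by gcongr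
        _ = ‖lam‖⁻¹ := by rw [zpow_add_one₀ hl0.ne']; field_simp
  choose n hn1 hn2 using hn
  set H : ℕ → ℂ → ℂ := fun k z => lam ^ (n (k0 + k + 1)) * φ (F.word (w (k0 + k + 1)) z) with hH
  have hU : ∀ k, ∀ x ∈ F.Ω, F.word (w (k0 + k + 1)) x ∈ ball b r := fun k => hk0 (k0 + k) (by omega)
  have hHd : ∀ k, DifferentiableOn ℂ (H k) F.Ω := fun k =>
    (hφd.comp (F.word_diff _) (hU k)).const_mul _
  have hbb : b ∈ ball b r := mem_ball_self hr
  have hHb : ∀ k, ∀ z ∈ closedBall x0 r1, ‖H k z‖ ≤ 2 * Co * ‖lam‖⁻¹ + 1 := by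
    intro k z hz
    have h1 := (hφ _ (hU k z (hr1Ω hz)) b hbb).2
    have h2 := hCo (w (k0 + k + 1)) z (Or.inl hz) (a (k0 + k + 1)) (Or.inr (haA _))
    rw [hwa] at h2
    rw [hφb, sub_zero] at h1
    have h3 := hn2 (k0 + k + 1)
    simp only [hH]
    rw [norm_mul]
    calc _ ≤ ‖lam ^ (n (k0 + k + 1))‖ * (2 * (Co * ‖deriv (F.word (w (k0 + k + 1))) x0‖)) := by
            gcongr; exact h1.trans (by gcongr)
      _ = 2 * Co * (‖lam ^ (n (k0 + k + 1))‖ * ‖deriv (F.word (w (k0 + k + 1))) x0‖) := by ring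
      _ ≤ 2 * Co * ‖lam‖⁻¹ := by gcongr
      _ ≤ _ := by linarith
  obtain ⟨j, k, hjk, hcl, hcl'⟩ := aux_montel F.hopen hr1 (by positivity) hr1Ω H hHd hHb hε
  have hHinj : InjOn (H j) F.Ω := by
    intro x hx y hy hxy
    simp only [hH] at hxy
    have h1 := mul_left_cancel₀ (zpow_ne_zero _ hlam) hxy
    have h2 := (hφ _ (hU j x hx) _ (hU j y hy)).1
    rw [h1, sub_self, norm_zero, mul_zero] at h2
    exact F.word_inj _ hx hy (sub_eq_zero.1 (norm_le_zero_iff.1 h2))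
  have hvan := hcore (H j) (H k) (hHd j) (hHd k) hHinj ?_ ?_ hcl hcl'
  rotate_left
  · intro u a' ha' y hy
    have hyc : y ∈ closedBall a' ρ := sphere_subset_closedBall hy
    have hyΩ := hρΩ a' ha' hyc
    have h1 := (hφ _ (hU j _ (F.word_mem u hyΩ)) _ (hU j _ (F.word_mem u (hAΩ ha')))).1
    have h2 := (hlow a' ha').2 (w (k0 + j + 1) ++ u) y (hsub1 _ hyc)
    rw [F.deriv_word_append _ _ (hAΩ ha'), norm_mul, F.word_append', F.word_append'] at h2
    rw [mem_sphere, dist_eq_norm] at hy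
    rw [hy] at h2
    have h3 := hC (w (k0 + j + 1)) x0 hx0 _ (F.att_word hA u ha')
    have h4 := hC u x0 hx0 a' ha'
    have h5 := hn1 (k0 + j + 1)
    simp only [hH]
    rw [← mul_sub, norm_mul]
    set Dw := ‖deriv (F.word (w (k0 + j + 1))) (F.word u a')‖
    set Du := ‖deriv (F.word u) a'‖
    set Dw0 := ‖deriv (F.word (w (k0 + j + 1))) x0‖
    set Du0 := ‖deriv (F.word u) x0‖
    set μ := ‖lam ^ n (k0 + j + 1)‖
    have hμ : 0 ≤ μ := norm_nonneg _
    have hDw : 0 ≤ Dw := norm_nonneg _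
    have hDu0 : 0 ≤ Du0 := norm_nonneg _
    have h6 : Du0 ≤ μ * Dw0 * Du0 := le_mul_of_one_le_left hDu0 h5
    have h7 : μ * Dw0 * Du0 ≤ μ * (C * Dw) * (C * Du) := by gcongr
    have h8 : μ * (Dw * Du * ρ / 2) ≤ μ * (2 * ‖φ (F.word (w (k0 + j + 1)) (F.word u y)) - φ (F.word (w (k0 + j + 1)) (F.word u a'))‖) :=
      mul_le_mul_of_nonneg_left (h2.trans h1) hμ
    calc ρ / (4 * C ^ 2) * Du0 ≤ ρ / (4 * C ^ 2) * (μ * (C * Dw) * (C * Du)) := by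
          gcongr; exact h6.trans h7
      _ = μ * (Dw * Du * ρ / 2) / 2 := by field_simp; ring
      _ ≤ _ := by linarith
  · intro z hz u a' ha' y hy he
    have hyΩ := hρΩ a' ha' hy
    simp only [hH] at he
    have h1 : φ (F.word (w (k0 + j + 1)) (F.word u y)) =
        lam ^ (n (k0 + k + 1) - n (k0 + j + 1)) * φ (F.word (w (k0 + k + 1)) z) := by
      rw [zpow_sub₀ hlam, div_mul_eq_mul_div, eq_div_iff (zpow_ne_zero _ hlam), mul_comm, he]
    have h2 := htr2 _ _ (hU j _ (F.word_mem u hyΩ)) _ (hU k _ (hAΩ hz)) h1 (F.att_word hA _ hz)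
    rw [← F.word_append'] at h2
    exact (hback a' ha').2 _ y (hsub2 _ hy) h2
  -- identity theorem
  have hzero : EqOn (fun z => H k z - H j z) 0 F.Ω := by
    have han : AnalyticOnNhd ℂ (fun z => H k z - H j z) F.Ω :=
      ((hHd k).fun_sub (hHd j)).analyticOnNhd F.hopen
    refine han.eqOn_zero_of_preconnected_of_frequently_eq_zero F.hconn.isPreconnected hx0Ω ?_
    have hbn : ∀ᶠ z in 𝓝[≠] x0, z ∈ ball x0 (r1 / 4 / 2) :=
      nhdsWithin_le_nhds (ball_mem_nhds x0 (by positivity))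
    exact (hacc.and_eventually hbn).mono fun z hz => hvan z hz.1 hz.2
  obtain ⟨u, hu, hwk⟩ := hpre (k0 + j + 1) (k0 + k + 1) (by omega)
  set v := w (k0 + j + 1) with hv
  have hvU : ∀ x ∈ F.Ω, F.word v x ∈ ball b r := hU j
  have hveq : ∀ z ∈ F.Ω, φ (F.word v (F.word u z)) =
      lam ^ (n (k0 + j + 1) - n (k0 + k + 1)) * φ (F.word v z) := by
    intro z hz
    have h1 : H k z - H j z = 0 := hzero hz
    have h2 := sub_eq_zero.1 h1
    simp only [hH] at h2
    rw [hwk, F.word_append'] at h2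
    rw [zpow_sub₀ hlam, div_mul_eq_mul_div, eq_div_iff (zpow_ne_zero _ hlam), mul_comm, h2]
  set N := n (k0 + j + 1) - n (k0 + k + 1) with hN
  set p := a (k0 + j + 1) with hp
  have hpΩ : p ∈ F.Ω := hAΩ (haA _)
  have hvp : F.word v p = b := hwa _
  have hφinj : ∀ p ∈ ball b r, ∀ q ∈ ball b r, φ p = φ q → p = q := by
    intro p hp q hq h
    have := (hφ p hp q hq).1
    rw [h, sub_self, norm_zero, mul_zero] at this
    exact sub_eq_zero.1 (norm_le_zero_iff.1 this)
  have hup : F.word u p = p := by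
    have h1 := hveq p hpΩ
    rw [hvp, hφb, mul_zero, ← hφb] at h1
    have h2 := hφinj _ (hvU _ (F.word_mem u hpΩ)) _ hbb h1
    exact F.word_inj v (F.word_mem u hpΩ) hpΩ (by rw [h2, hvp])
  have hNpos : 0 < N := by
    by_contra! hN0
    have hcd : DifferentiableOn ℂ (φ ∘ F.word v) F.Ω := hφd.comp (F.word_diff v) hvU
    have hci : InjOn (φ ∘ F.word v) F.Ω := fun x hx y hy h =>
      F.word_inj v hx hy (hφinj _ (hvU x hx) _ (hvU y hy) h)
    have hne := aux_deriv_ne_zero F.hopen hcd hci hpΩ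
    have hev : ((φ ∘ F.word v) ∘ F.word u) =ᶠ[𝓝 p] fun z => lam ^ N * (φ ∘ F.word v) z := by
      filter_upwards [F.hopen.mem_nhds hpΩ] with z hz using hveq z hz
    have hda : DifferentiableAt ℂ (φ ∘ F.word v) p := hcd.differentiableAt (F.hopen.mem_nhds hpΩ)
    have h1 := hev.deriv_eq
    rw [deriv_comp p (by rw [hup]; exact hda) (F.word_diffAt u hpΩ), hup, deriv_const_mul _ hda,
      mul_comm] at h1
    have h2 := mul_right_cancel₀ hne h1
    have h3 := F.fix_deriv hu hpΩ hup
    rw [h2, norm_zpow] at h3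
    exact absurd h3 (not_lt.2 (one_le_zpow_of_nonpos₀ hl0 hl1.le hN0))
  obtain ⟨M, hM⟩ := Int.eq_ofNat_of_zero_le hNpos.le
  have hM1 : 1 ≤ M := by omega
  have hiter : ∀ x ∈ F.Ω, (G.g i)^[M] (F.word v x) = F.word v (F.word u x) := by
    intro x hx
    refine (htr1 M _ (hvU _ (F.word_mem u hx)) _ (hvU x hx) ?_).symm
    rw [hveq x hx, hM]; simp
  refine ⟨v, u, M, ?_, hu, hM1, (G.g i)^[M], b, hiter, ⟨p, hpΩ, hvp⟩,
    Function.iterate_fixed hgb M, F.word v '' F.Ω, F.word_image_open v, ⟨p, hpΩ, hvp⟩, subset_rfl, ?_, hgb,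
    fun z _ => rfl⟩
  · intro h
    have := congrArg List.length h
    rw [hv, hwl] at this
    simp at this
  · refine (G.hdiff i).mono ?_
    rintro _ ⟨x, hx, rfl⟩
    exact hrG (hvU x hx)

end Helpers

/-- Theorem: let `F` be a holomorphic IFS with the SSC and attractor `A`, and for finite
words `v, ṽ` let `R_{v,ṽ} = f_v ∘ f_ṽ ∘ f_v⁻¹` (characterized by `R ∘ f_v = f_v ∘ f_ṽ`
on `Ω_F`). Then (i) `R_{v,ṽ}` maps `f_v(Ω_F)` into itself and has a unique fixed point
`b` there, and for each `l ≥ 1` there are precisely `l` different (as germs at `b`) local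
solutions of `g^l = R_{v,ṽ}` near `b`; (ii) if `G` is any other holomorphic IFS with the
SSC and the same attractor `A`, then there is `K ∈ ℕ` such that every `g_i ∈ G` is a
holomorphic continuation of one of these local solutions with `l ≤ K` (equivalently,
`g_i` itself is a local solution of `g^l = R_{v,ṽ}` at `b` for some `v, ṽ, l ≤ K`). -/
theorem stmt_16 (F : HolIFS) (A : Set ℂ)
    (hA : F.IsAttractor A) (hA2 : A.Nontrivial) (hSSC : F.SSC A) :
    (∀ v vt : List (Fin F.m), v ≠ [] → vt ≠ [] →
      ∀ R : ℂ → ℂ, (∀ x ∈ F.Ω, R (F.word v x) = F.word v (F.word vt x)) →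
        (R '' (F.word v '' F.Ω) ⊆ F.word v '' F.Ω) ∧
        (∃! b, b ∈ F.word v '' F.Ω ∧ R b = b) ∧
        ∀ b, b ∈ F.word v '' F.Ω → R b = b →
          ∀ l : ℕ, 1 ≤ l →
            ∃ gs : Fin l → ℂ → ℂ,
              (∀ s, IsLocalSolOn R (F.word v '' F.Ω) b l (gs s)) ∧
              (∀ s s' : Fin l, s ≠ s' → ¬ (gs s =ᶠ[nhds b] gs s')) ∧
              (∀ h : ℂ → ℂ, IsLocalSolOn R (F.word v '' F.Ω) b l h →
                ∃ s, h =ᶠ[nhds b] gs s)) ∧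
    (∀ G : HolIFS, G.IsAttractor A → G.SSC A →
      ∃ K : ℕ, 1 ≤ K ∧ ∀ i : Fin G.m,
        ∃ (v vt : List (Fin F.m)) (l : ℕ), v ≠ [] ∧ vt ≠ [] ∧ 1 ≤ l ∧ l ≤ K ∧
          ∃ (R : ℂ → ℂ) (b : ℂ),
            (∀ x ∈ F.Ω, R (F.word v x) = F.word v (F.word vt x)) ∧
            b ∈ F.word v '' F.Ω ∧ R b = b ∧
            IsLocalSolOn R (F.word v '' F.Ω) b l (G.g i)) := by
  refine ⟨part_one F A hA, fun G hGA hGS => ?_⟩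
  choose v vt l hv hvt hl hR using part_two_one F A hA hA2 hSSC G hGA hGS
  refine ⟨Finset.univ.sup l + 1, by omega, fun i => ?_⟩
  exact ⟨v i, vt i, l i, hv i, hvt i, hl i,
    (Finset.le_sup (f := l) (Finset.mem_univ i)).trans (Nat.le_succ _), hR i⟩
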